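/- arXiv:2112.08469 — 12 statements merged into one kernel-verified Lean document; each statement's English description precedes it below -/
import Mathlib

section
/- For all Z, W ∈ k one has −Σ_j ⟨[Z_j,[Z_j,Z]], W⟩ = ⟨Z,W⟩ + tr_p((ad Z)|_p ∘ (ad W)|_p), where (ad Z)|_p denotes the restriction of ad Z to an endomorphism of p (well defined since [k,p] ⊆ p) and tr_p denotes the trace on End(p). (Equivalently, the Casimir operator of the adjoint representation of k with respect to −κ|_k equals I_k + κ_χ, where κ_χ : k → k is defined by −κ(κ_χ Z, W) = tr((ad Z)|_p ∘ (ad W)|_p).) -/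
/-- In the setting of a compact semisimple real Lie algebra `g` with subalgebra
`k` and Killing-orthogonal complement `p` (with `[k,p] ⊆ p`), for all `Z, W ∈ k`:
`-∑ j ⟨[Z j, [Z j, Z]], W⟩ = ⟨Z, W⟩ + tr_p((ad Z)|_p ∘ (ad W)|_p)`. -/
theorem stmt1
    {g : Type*} [LieRing g] [LieAlgebra ℝ g] [Module.Finite ℝ g]
    (hneg : ∀ x : g, x ≠ 0 → killingForm ℝ g x x < 0)
    (k : LieSubalgebra ℝ g) (p : Submodule ℝ g)
    (hp : ∀ x : g, x ∈ p ↔ ∀ z ∈ k, killingForm ℝ g x z = 0)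
    (hkp : ∀ z ∈ k, ∀ x ∈ p, ⁅z, x⁆ ∈ p)
    (prk prp : g →ₗ[ℝ] g)
    (hprk : ∀ x : g, prk x ∈ k) (hprp : ∀ x : g, prp x ∈ p)
    (hsum : ∀ x : g, prk x + prp x = x)
    {nk np : ℕ} (Z : Fin nk → g) (X : Fin np → g)
    (hZk : ∀ j, Z j ∈ k) (hXp : ∀ i, X i ∈ p)
    (hZon : ∀ j j' : Fin nk,
      -(killingForm ℝ g (Z j) (Z j')) = if j = j' then (1 : ℝ) else 0)
    (hXon : ∀ i i' : Fin np,
      -(killingForm ℝ g (X i) (X i')) = if i = i' then (1 : ℝ) else 0)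
    (hZspan : Submodule.span ℝ (Set.range Z) = k.toSubmodule)
    (hXspan : Submodule.span ℝ (Set.range X) = p) :
    ∀ (z : g) (hz : z ∈ k) (w : g) (hw : w ∈ k),
      -(∑ j, -(killingForm ℝ g ⁅Z j, ⁅Z j, z⁆⁆ w)) =
        -(killingForm ℝ g z w) +
          LinearMap.trace ℝ p
            (((LieAlgebra.ad ℝ g z).restrict
                (fun x hx => by rw [LieAlgebra.ad_apply]; exact hkp z hz x hx)) ∘ₗ
             ((LieAlgebra.ad ℝ g w).restrict
                (fun x hx => by rw [LieAlgebra.ad_apply]; exact hkp w hw x hx))) := by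
  intro z hz w hw
  have hprpp : ∀ x ∈ p, prp x = x := by
    intro x hx
    have h0 : prk x = 0 := by
      by_contra hne
      have h1 : prk x ∈ p := by
        have : prk x = x - prp x := by rw [eq_sub_iff_add_eq]; exact hsum x
        rw [this]; exact p.sub_mem hx (hprp x)
      have h2 := (hp _).1 h1 _ (hprk x)
      have h3 := hneg _ hne
      rw [h2] at h3
      exact lt_irrefl _ h3
    have := hsum x
    rwa [h0, zero_add] at this
  have hexp : ∀ y ∈ k, y = ∑ j, (-(killingForm ℝ g (Z j) y)) • Z j := by
    intro y hy
    have hy' : y ∈ Submodule.span ℝ (Set.range Z) := by rw [hZspan]; exact hy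
    obtain ⟨c, rfl⟩ := (Submodule.mem_span_range_iff_exists_fun ℝ).1 hy'
    refine Finset.sum_congr rfl fun j _ => ?_
    congr 1
    rw [map_sum, ← Finset.sum_neg_distrib]
    simp only [map_smul, smul_eq_mul, ← mul_neg, hZon]
    simp
  have hprk' : ∀ x, prk x = ∑ j, (-(killingForm ℝ g (Z j) x)) • Z j := by
    intro x
    rw [hexp _ (hprk x)]
    refine Finset.sum_congr rfl fun j _ => ?_
    have h1 : killingForm ℝ g (Z j) (prp x) = 0 := by
      rw [LieModule.traceForm_comm]
      exact (hp _).1 (hprp x) _ (hZk j)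
    have h2 : killingForm ℝ g (Z j) x = killingForm ℝ g (Z j) (prk x) := by
      conv_lhs => rw [← hsum x, map_add, h1, add_zero]
    rw [h2]
  set T : g →ₗ[ℝ] g := LieAlgebra.ad ℝ g z ∘ₗ LieAlgebra.ad ℝ g w with hT
  have htot : killingForm ℝ g z w = LinearMap.trace ℝ g (T ∘ₗ prk) +
      LinearMap.trace ℝ g (T ∘ₗ prp) := by
    rw [killingForm_apply_apply, ← map_add, ← LinearMap.comp_add]
    have : prk + prp = LinearMap.id := LinearMap.ext hsum
    rw [this, LinearMap.comp_id]
  have hk : LinearMap.trace ℝ g (T ∘ₗ prk) = ∑ j, -(killingForm ℝ g (Z j) (T (Z j))) := by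
    have : T ∘ₗ prk = ∑ j, (-(killingForm ℝ g (Z j))).smulRight (T (Z j)) := by
      ext x
      simp only [LinearMap.comp_apply, hprk', map_sum, map_smul, LinearMap.sum_apply,
        LinearMap.smulRight_apply, LinearMap.neg_apply]
    rw [this, map_sum]
    simp only [LinearMap.trace_smulRight, LinearMap.neg_apply]
  have hpp : LinearMap.trace ℝ g (T ∘ₗ prp) = LinearMap.trace ℝ p
            (((LieAlgebra.ad ℝ g z).restrict
                (fun x hx => by rw [LieAlgebra.ad_apply]; exact hkp z hz x hx)) ∘ₗ
             ((LieAlgebra.ad ℝ g w).restrict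
                (fun x hx => by rw [LieAlgebra.ad_apply]; exact hkp w hw x hx))) := by
    have h1 : T ∘ₗ prp = (T ∘ₗ p.subtype) ∘ₗ (prp.codRestrict p hprp) := by
      ext x; rfl
    rw [h1, LinearMap.trace_comp_comm']
    congr 1
    ext x
    exact hprpp _ (hkp z hz _ (hkp w hw _ x.2))
  rw [← hpp, htot, hk]
  have hterm : ∀ j, killingForm ℝ g ⁅Z j, ⁅Z j, z⁆⁆ w = killingForm ℝ g (Z j) (T (Z j)) := by
    intro j
    have e : T (Z j) = ⁅z, ⁅w, Z j⁆⁆ := rfl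
    rw [e, LieModule.traceForm_apply_lie_apply ℝ g g (Z j) ⁅Z j, z⁆ w,
      ← LieModule.traceForm_apply_lie_apply ℝ g g (Z j) z, 
      LieModule.traceForm_comm, LieModule.traceForm_apply_lie_apply ℝ g g ⁅Z j, z⁆ w (Z j) |>.symm]
  simp only [hterm, Finset.sum_neg_distrib]
  ring
end

section
/- For every X ∈ p one has Σ_i pr_k([X_i, pr_p[X_i, X]]) = 0. (Equivalently, Σ_i a(X_i) ∘ ad_p(X_i) = 0, where a(X)Y = pr_k[X,Y] and ad_p(X)Y = pr_p[X,Y].) -/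
theorem trace_aux {g ι : Type*} [AddCommGroup g] [Module ℝ g] [Fintype ι] [DecidableEq ι]
    (B : LinearMap.BilinForm ℝ g) (b : ι → g)
    (hon : ∀ i j, -(B (b i) (b j)) = if i = j then (1 : ℝ) else 0)
    (hspan : ⊤ ≤ Submodule.span ℝ (Set.range b)) (f : g →ₗ[ℝ] g) :
    LinearMap.trace ℝ g f = ∑ i, -(B (f (b i)) (b i)) := by
  have hB : ∀ i j, B (b i) (b j) = if i = j then (-1 : ℝ) else 0 := by
    intro i j
    have := hon i j
    split_ifs at this ⊢ <;> linarith
  have hli : LinearIndependent ℝ b := by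
    rw [Fintype.linearIndependent_iff]
    intro c hc i
    have h := congrArg (fun v => B v (b i)) hc
    simpa [hB] using h
  let bb := Module.Basis.mk hli hspan
  rw [LinearMap.trace_eq_matrix_trace ℝ bb, Matrix.trace]
  refine Finset.sum_congr rfl fun i _ => ?_
  rw [Matrix.diag_apply, LinearMap.toMatrix_apply]
  have h2 : bb i = b i := by simp [bb]
  rw [h2]
  have h := bb.sum_repr (f (b i))
  have h3 := congrArg (fun v => B v (b i)) h
  simp only [bb, Module.Basis.coe_mk] at h3
  simp only [map_sum, map_smul, LinearMap.sum_apply, LinearMap.smul_apply, hB] at h3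
  simp only [smul_eq_mul, mul_ite, mul_neg, mul_one, mul_zero, Finset.sum_ite_eq',
    Finset.mem_univ, if_true] at h3
  simp only [bb]
  linarith

/-- In the setting of a compact semisimple real Lie algebra `g` with subalgebra
`k` and Killing-orthogonal complement `p`, for every `X ∈ p`:
`∑ i prk([X i, prp [X i, X]]) = 0`. -/
theorem stmt2
    {g : Type*} [LieRing g] [LieAlgebra ℝ g] [Module.Finite ℝ g]
    (hneg : ∀ x : g, x ≠ 0 → killingForm ℝ g x x < 0)
    (k : LieSubalgebra ℝ g) (p : Submodule ℝ g)
    (hp : ∀ x : g, x ∈ p ↔ ∀ z ∈ k, killingForm ℝ g x z = 0)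
    (prk prp : g →ₗ[ℝ] g)
    (hprk : ∀ x : g, prk x ∈ k) (hprp : ∀ x : g, prp x ∈ p)
    (hsum : ∀ x : g, prk x + prp x = x)
    {nk np : ℕ} (Z : Fin nk → g) (X : Fin np → g)
    (hZk : ∀ j, Z j ∈ k) (hXp : ∀ i, X i ∈ p)
    (hZon : ∀ j j' : Fin nk,
      -(killingForm ℝ g (Z j) (Z j')) = if j = j' then (1 : ℝ) else 0)
    (hXon : ∀ i i' : Fin np,
      -(killingForm ℝ g (X i) (X i')) = if i = i' then (1 : ℝ) else 0)
    (hZspan : Submodule.span ℝ (Set.range Z) = k.toSubmodule)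
    (hXspan : Submodule.span ℝ (Set.range X) = p) :
    ∀ x ∈ p, ∑ i, prk ⁅X i, prp ⁅X i, x⁆⁆ = 0 := by
  have hinv : ∀ a b c : g, killingForm ℝ g ⁅a, b⁆ c = killingForm ℝ g a ⁅b, c⁆ :=
    fun a b c => LieModule.traceForm_apply_lie_apply ℝ g g a b c
  have hcomm : ∀ a b : g, killingForm ℝ g a b = killingForm ℝ g b a :=
    fun a b => LieModule.traceForm_comm ℝ g g a b
  intro x hx
  have hon : ∀ i j : Fin nk ⊕ Fin np,
      -(killingForm ℝ g (Sum.elim Z X i) (Sum.elim Z X j)) = if i = j then (1 : ℝ) else 0 := by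
    rintro (i | i) (j | j)
    · simpa using hZon i j
    · simp [hcomm (Z i), (hp _).1 (hXp j) _ (hZk i)]
    · simp [(hp _).1 (hXp i) _ (hZk j)]
    · simpa using hXon i j
  have hspan : ⊤ ≤ Submodule.span ℝ (Set.range (Sum.elim Z X)) := by
    intro v _
    rw [Set.Sum.elim_range, Submodule.span_union, hZspan, hXspan, ← hsum v]
    exact Submodule.add_mem_sup (hprk v) (hprp v)
  have key : ∀ z ∈ k, ∑ i, killingForm ℝ g ⁅x, X i⁆ ⁅z, X i⁆ = 0 := by
    intro z hz
    have h := (hp x).1 hx z hz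
    rw [hcomm, killingForm_apply_apply, trace_aux (killingForm ℝ g) _ hon hspan,
      Fintype.sum_sum_type] at h
    have e : ∀ y : g, -(killingForm ℝ g ⁅z, ⁅x, y⁆⁆ y) = killingForm ℝ g ⁅x, y⁆ ⁅z, y⁆ := by
      intro y
      rw [← lie_skew z, map_neg, LinearMap.neg_apply, neg_neg, hinv]
    simp only [Sum.elim_inl, Sum.elim_inr, LinearMap.comp_apply, LieAlgebra.ad_apply, e] at h
    rw [Finset.sum_eq_zero, zero_add] at h
    · exact h
    · intro j _
      rw [hinv]
      exact (hp x).1 hx _ (k.lie_mem (hZk j) (k.lie_mem hz (hZk j)))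
  have hzp : ∀ z ∈ k, ∀ y ∈ p, ⁅z, y⁆ ∈ p := by
    intro z hz y hy
    rw [hp]
    intro w hw
    rw [← lie_skew, map_neg, LinearMap.neg_apply, hinv, (hp y).1 hy _ (k.lie_mem hz hw), neg_zero]
  have hterm : ∀ z ∈ k, ∀ i, killingForm ℝ g (prk ⁅X i, prp ⁅X i, x⁆⁆) z
      = -(killingForm ℝ g ⁅x, X i⁆ ⁅z, X i⁆) := by
    intro z hz i
    have h1 : ∀ v, killingForm ℝ g (prk v) z = killingForm ℝ g v z := by
      intro v
      conv_rhs => rw [← hsum v]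
      rw [map_add, LinearMap.add_apply, (hp _).1 (hprp v) z hz, add_zero]
    have h2 : ∀ v, killingForm ℝ g (prp v) ⁅z, X i⁆ = killingForm ℝ g v ⁅z, X i⁆ := by
      intro v
      conv_rhs => rw [← hsum v]
      rw [map_add, LinearMap.add_apply, hcomm (prk v),
        (hp _).1 (hzp z hz _ (hXp i)) _ (hprk v), zero_add]
    have h3 : ∀ v, killingForm ℝ g ⁅X i, v⁆ z = killingForm ℝ g v ⁅z, X i⁆ := by
      intro v
      rw [← lie_skew, map_neg, LinearMap.neg_apply, hinv, ← lie_skew z, map_neg]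
    rw [h1, h3, h2, ← lie_skew x (X i), map_neg, LinearMap.neg_apply, neg_neg]
  by_contra hne
  have hk : ∑ i, prk ⁅X i, prp ⁅X i, x⁆⁆ ∈ k := sum_mem fun i _ => hprk _
  have h0 := hneg _ hne
  generalize hy : ∑ i, prk ⁅X i, prp ⁅X i, x⁆⁆ = y at *
  have : killingForm ℝ g y y = 0 := by
    have e : ∀ w ∈ k, killingForm ℝ g y w = 0 := by
      intro w hw
      rw [← hy, map_sum, LinearMap.sum_apply, Finset.sum_congr rfl fun i _ => hterm w hw i,
        Finset.sum_neg_distrib, key w hw, neg_zero]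
    exact e y hk
  linarith
end

section
/- For every X ∈ p one has −2 Σ_j [Z_j,[Z_j,X]] − Σ_i pr_p([X_i, pr_p[X_i,X]]) = X. (Equivalently, 2·Cas_χ − 4·M_{l_p} = I_p, where Cas_χ = −Σ_j ((ad Z_j)|_p)² is the Casimir operator of the isotropy representation and M_{l_p} = (1/4) Σ_i (ad_p X_i)² with ad_p(X)Y = pr_p[X,Y].) -/
theorem aux_expand {g : Type*} [LieRing g] [LieAlgebra ℝ g] {n : ℕ} (Z : Fin n → g)
    (hZon : ∀ j j' : Fin n,
      -(killingForm ℝ g (Z j) (Z j')) = if j = j' then (1 : ℝ) else 0)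
    (v : g) (hv : v ∈ Submodule.span ℝ (Set.range Z)) :
    v = -∑ j, killingForm ℝ g v (Z j) • Z j := by
  obtain ⟨c, rfl⟩ := (Submodule.mem_span_range_iff_exists_fun ℝ).1 hv
  have h : ∀ j, killingForm ℝ g (∑ i, c i • Z i) (Z j) = - c j := by
    intro j
    have h1 : ∀ i, killingForm ℝ g (Z i) (Z j) = if i = j then (-1 : ℝ) else 0 := by
      intro i
      have := hZon i j
      split_ifs at this ⊢ <;> linarith
    simp [map_sum, LinearMap.sum_apply, h1]
  simp only [h]
  simp

theorem aux_inv {g : Type*} [LieRing g] [LieAlgebra ℝ g] (x y z : g) :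
    killingForm ℝ g ⁅x, y⁆ z = killingForm ℝ g x ⁅y, z⁆ :=
  LieModule.traceForm_apply_lie_apply ℝ g g x y z

theorem aux_inv2 {g : Type*} [LieRing g] [LieAlgebra ℝ g] (x y z : g) :
    killingForm ℝ g ⁅x, y⁆ z = - killingForm ℝ g y ⁅x, z⁆ := by
  rw [← lie_skew, map_neg, LinearMap.neg_apply, aux_inv]

theorem aux_comm {g : Type*} [LieRing g] [LieAlgebra ℝ g] (x y : g) :
    killingForm ℝ g x y = killingForm ℝ g y x :=
  LieModule.traceForm_comm ℝ g g x y

theorem aux_trace {g : Type*} [LieRing g] [LieAlgebra ℝ g] [Module.Finite ℝ g]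
    {n m : ℕ} (Z : Fin n → g) (X : Fin m → g)
    (h : ∀ v, v = -∑ j, killingForm ℝ g v (Z j) • Z j - ∑ j, killingForm ℝ g v (X j) • X j)
    (f : g →ₗ[ℝ] g) :
    LinearMap.trace ℝ g f =
      -∑ j, killingForm ℝ g (f (Z j)) (Z j) - ∑ j, killingForm ℝ g (f (X j)) (X j) := by
  have hf : f = -∑ j, ((killingForm ℝ g (Z j)).comp f).smulRight (Z j)
      - ∑ j, ((killingForm ℝ g (X j)).comp f).smulRight (X j) := by
    ext v
    have := h (f v)
    simp only [LinearMap.sub_apply, LinearMap.neg_apply, LinearMap.sum_apply,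
      LinearMap.smulRight_apply, LinearMap.comp_apply]
    simpa only [aux_comm (f v)] using this
  conv_lhs => rw [hf]
  simp only [map_sub, map_neg, map_sum, LinearMap.trace_smulRight, LinearMap.comp_apply]
  simp only [aux_comm (f _)]

/-- In the setting of a compact semisimple real Lie algebra `g` with subalgebra
`k` and Killing-orthogonal complement `p`, for every `X ∈ p`:
`-2 ∑ j [Z j, [Z j, X]] - ∑ i prp([X i, prp [X i, X]]) = X`. -/
theorem stmt3
    {g : Type*} [LieRing g] [LieAlgebra ℝ g] [Module.Finite ℝ g]
    (hneg : ∀ x : g, x ≠ 0 → killingForm ℝ g x x < 0)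
    (k : LieSubalgebra ℝ g) (p : Submodule ℝ g)
    (hp : ∀ x : g, x ∈ p ↔ ∀ z ∈ k, killingForm ℝ g x z = 0)
    (prk prp : g →ₗ[ℝ] g)
    (hprk : ∀ x : g, prk x ∈ k) (hprp : ∀ x : g, prp x ∈ p)
    (hsum : ∀ x : g, prk x + prp x = x)
    {nk np : ℕ} (Z : Fin nk → g) (X : Fin np → g)
    (hZk : ∀ j, Z j ∈ k) (hXp : ∀ i, X i ∈ p)
    (hZon : ∀ j j' : Fin nk,
      -(killingForm ℝ g (Z j) (Z j')) = if j = j' then (1 : ℝ) else 0)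
    (hXon : ∀ i i' : Fin np,
      -(killingForm ℝ g (X i) (X i')) = if i = i' then (1 : ℝ) else 0)
    (hZspan : Submodule.span ℝ (Set.range Z) = k.toSubmodule)
    (hXspan : Submodule.span ℝ (Set.range X) = p) :
    ∀ x ∈ p,
      -((2 : ℝ) • ∑ j, ⁅Z j, ⁅Z j, x⁆⁆) - ∑ i, prp ⁅X i, prp ⁅X i, x⁆⁆ = x := by
  intro x hx
  have eK : ∀ v ∈ k, v = -∑ j, killingForm ℝ g v (Z j) • Z j := fun v hv =>
    aux_expand Z hZon v (by rw [hZspan]; exact hv)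
  have eP : ∀ v ∈ p, v = -∑ j, killingForm ℝ g v (X j) • X j := fun v hv =>
    aux_expand X hXon v (by rw [hXspan]; exact hv)
  have kp : ∀ z ∈ k, ∀ y ∈ p, killingForm ℝ g z y = 0 := fun z hz y hy => by
    rw [aux_comm]; exact (hp y).1 hy z hz
  have pk : ∀ y ∈ p, ∀ z ∈ k, killingForm ℝ g y z = 0 := fun y hy z hz => (hp y).1 hy z hz
  have lkp : ∀ z ∈ k, ∀ y ∈ p, ⁅z, y⁆ ∈ p := by
    intro z hz y hy
    rw [hp]
    intro w hw
    rw [aux_inv2, pk y hy _ (k.lie_mem hz hw), neg_zero]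
  -- pairing with projections
  have prp_pair : ∀ u, ∀ y ∈ p, killingForm ℝ g (prp u) y = killingForm ℝ g u y := by
    intro u y hy
    conv_rhs => rw [← hsum u]
    rw [map_add, LinearMap.add_apply, kp _ (hprk u) y hy, zero_add]
  have prk_pair : ∀ u, ∀ z ∈ k, killingForm ℝ g (prk u) z = killingForm ℝ g u z := by
    intro u z hz
    conv_rhs => rw [← hsum u]
    rw [map_add, LinearMap.add_apply, pk _ (hprp u) z hz, add_zero]
  have eKu : ∀ u, prk u = -∑ j, killingForm ℝ g u (Z j) • Z j := by
    intro u
    have := eK _ (hprk u)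
    simpa only [prk_pair u _ (hZk _)] using this
  have ePu : ∀ u, prp u = -∑ j, killingForm ℝ g u (X j) • X j := by
    intro u
    have := eP _ (hprp u)
    simpa only [prp_pair u _ (hXp _)] using this
  have eG : ∀ v, v = -∑ j, killingForm ℝ g v (Z j) • Z j
      - ∑ j, killingForm ℝ g v (X j) • X j := by
    intro v
    conv_lhs => rw [← hsum v, eKu, ePu]
    rw [sub_eq_add_neg]
  have key : ∀ y, killingForm ℝ g x y = ∑ j, killingForm ℝ g ⁅Z j, x⁆ ⁅Z j, y⁆
      + ∑ i, killingForm ℝ g ⁅X i, x⁆ ⁅X i, y⁆ := by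
    intro y
    have e : ∀ w : g, killingForm ℝ g ⁅x, ⁅y, w⁆⁆ w = - killingForm ℝ g ⁅w, x⁆ ⁅w, y⁆ := by
      intro w
      rw [aux_inv2, aux_comm, ← lie_skew x w, ← lie_skew y w,
        map_neg, map_neg, LinearMap.neg_apply, neg_neg]
    rw [killingForm_apply_apply, aux_trace Z X eG]
    simp only [LinearMap.comp_apply, LieAlgebra.ad_apply, e, Finset.sum_neg_distrib]
    ring
  have split : ∀ y ∈ p, ∑ i, killingForm ℝ g ⁅X i, x⁆ ⁅X i, y⁆
      = ∑ j, killingForm ℝ g ⁅Z j, x⁆ ⁅Z j, y⁆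
        + ∑ i, killingForm ℝ g (prp ⁅X i, x⁆) ⁅X i, y⁆ := by
    intro y hy
    have h1 : ∀ i, killingForm ℝ g ⁅X i, x⁆ ⁅X i, y⁆ =
        -∑ j, killingForm ℝ g ⁅X i, x⁆ (Z j) * killingForm ℝ g (Z j) ⁅X i, y⁆
          + killingForm ℝ g (prp ⁅X i, x⁆) ⁅X i, y⁆ := by
      intro i
      conv_lhs => rw [← hsum ⁅X i, x⁆, eKu]
      simp [map_sum, LinearMap.sum_apply]
    have h2 : ∀ j, killingForm ℝ g ⁅Z j, x⁆ ⁅Z j, y⁆ =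
        -∑ i, killingForm ℝ g ⁅Z j, x⁆ (X i) * killingForm ℝ g (X i) ⁅Z j, y⁆ := by
      intro j
      conv_lhs => rw [eP _ (lkp _ (hZk j) x hx)]
      simp [map_sum, LinearMap.sum_apply]
    have h3 : ∀ i j, killingForm ℝ g ⁅X i, x⁆ (Z j) * killingForm ℝ g (Z j) ⁅X i, y⁆
        = killingForm ℝ g ⁅Z j, x⁆ (X i) * killingForm ℝ g (X i) ⁅Z j, y⁆ := by
      intro i j
      rw [aux_inv (X i), ← lie_skew x (Z j), map_neg, aux_comm (X i) ⁅Z j, x⁆,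
        ← aux_inv (Z j) (X i) y, ← aux_inv (X i) (Z j) y, ← lie_skew (X i) (Z j), map_neg,
        LinearMap.neg_apply, neg_mul, mul_neg]
    rw [Finset.sum_congr rfl (fun i _ => h1 i), Finset.sum_add_distrib,
      Finset.sum_congr rfl (fun j _ => h2 j), Finset.sum_neg_distrib, Finset.sum_neg_distrib,
      Finset.sum_comm]
    simp only [h3]
  have hL : -((2 : ℝ) • ∑ j, ⁅Z j, ⁅Z j, x⁆⁆) - ∑ i, prp ⁅X i, prp ⁅X i, x⁆⁆ ∈ p :=
    p.sub_mem (p.neg_mem (p.smul_mem _ (p.sum_mem fun j _ =>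
      lkp _ (hZk j) _ (lkp _ (hZk j) x hx)))) (p.sum_mem fun i _ => hprp _)
  have hpair : ∀ y ∈ p, killingForm ℝ g
      (-((2 : ℝ) • ∑ j, ⁅Z j, ⁅Z j, x⁆⁆) - ∑ i, prp ⁅X i, prp ⁅X i, x⁆⁆) y
      = killingForm ℝ g x y := by
    intro y hy
    rw [key y, split y hy]
    simp only [map_sub, map_neg, map_smul, map_sum, LinearMap.sub_apply, LinearMap.neg_apply,
      LinearMap.smul_apply, LinearMap.sum_apply, prp_pair _ y hy]
    simp only [aux_inv2 _ _ y, Finset.sum_neg_distrib, smul_eq_mul]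
    ring
  by_contra hne
  have hlt := hneg _ (sub_ne_zero.2 hne)
  have h0 := hpair _ (p.sub_mem hL hx)
  rw [map_sub (killingForm ℝ g), LinearMap.sub_apply, h0, sub_self] at hlt
  exact lt_irrefl _ hlt
end

section
/- Suppose in addition that k = k_1 ⊕ ⋯ ⊕ k_s is a direct sum of ideals of k and that for each 1 ≤ i ≤ s the Killing form of the Lie algebra k_i equals c_i times the restriction of κ to k_i × k_i, for some real numbers c_1,…,c_s. Then −Σ_j tr_p((ad Z_j)|_p ∘ (ad Z_j)|_p) = Σ_{i=1}^s (1 − c_i)·dim k_i, where (ad Z)|_p denotes the restriction of ad Z to an endomorphism of p and tr_p denotes the trace on End(p). (This says that the trace of the Casimir operator of the isotropy representation equals Σ_i (1−c_i) dim k_i.) -/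
open LinearMap in
theorem aux_trace_basis {V : Type*} [AddCommGroup V] [Module ℝ V] (B : LinearMap.BilinForm ℝ V)
    {n : ℕ} (Z : Fin n → V) (W : Submodule ℝ V)
    (hon : ∀ j j' : Fin n, -(B (Z j) (Z j')) = if j = j' then (1 : ℝ) else 0)
    (hspan : Submodule.span ℝ (Set.range Z) = W) (f : V →ₗ[ℝ] V) (hf : ∀ x ∈ W, f x ∈ W) :
    LinearMap.trace ℝ W (f.restrict hf) = ∑ j, -(B (f (Z j)) (Z j)) := by
  subst hspan
  have hcoef : ∀ (a : Fin n → ℝ) (j : Fin n), -(B (∑ i, a i • Z i) (Z j)) = a j := by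
    intro a j
    have : ∀ i, B (Z i) (Z j) = -(if i = j then (1 : ℝ) else 0) := fun i => by
      rw [← hon]; ring
    simp [this]
  have hli : LinearIndependent ℝ Z := by
    rw [Fintype.linearIndependent_iff]
    intro a ha j
    rw [← hcoef a j, ha]; simp
  let b := Module.Basis.span hli
  have hb : ∀ j, ((b j : Submodule.span ℝ (Set.range Z)) : V) = Z j := fun j =>
    Module.Basis.coe_span_apply hli j
  rw [LinearMap.trace_eq_matrix_trace ℝ b, Matrix.trace]
  refine Finset.sum_congr rfl fun j _ => ?_
  rw [Matrix.diag_apply, LinearMap.toMatrix_apply]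
  have h := congrArg Subtype.val (b.sum_repr (f.restrict hf (b j)))
  simp only [LinearMap.coe_restrict_apply, hb, Submodule.coe_sum, Submodule.coe_smul] at h
  rw [← h, hcoef]

theorem aux_isCompl {V : Type*} [AddCommGroup V] [Module ℝ V] [Module.Finite ℝ V]
    (B : LinearMap.BilinForm ℝ V) (hB : B.IsRefl) (hneg : ∀ x : V, x ≠ 0 → B x x < 0)
    (W : Submodule ℝ V) : IsCompl W (B.orthogonal W) := by
  rw [LinearMap.BilinForm.isCompl_orthogonal_iff_disjoint hB, Submodule.disjoint_def]
  intro x hx hx'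
  by_contra h0
  have h1 := hneg x h0
  have h2 : B x x = 0 := hx' x hx
  linarith

theorem aux_trace_compl {V : Type*} [AddCommGroup V] [Module ℝ V] [Module.Finite ℝ V]
    (W U : Submodule ℝ V) (h : IsCompl W U) (f : V →ₗ[ℝ] V) (hW : ∀ x ∈ W, f x ∈ W)
    (hU : ∀ x ∈ U, f x ∈ U) :
    LinearMap.trace ℝ V f = LinearMap.trace ℝ W (f.restrict hW) +
      LinearMap.trace ℝ U (f.restrict hU) := by
  let N : Bool → Submodule ℝ V := fun b => if b then W else U
  have hN : DirectSum.IsInternal N :=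
    (DirectSum.isInternal_submodule_iff_isCompl N (i := true) (j := false) (by simp)
      (by ext x; cases x <;> simp)).2 h
  have hf : ∀ i, Set.MapsTo f (N i) (N i) := by
    intro i; cases i
    · exact hU
    · exact hW
  have := LinearMap.trace_eq_sum_trace_restrict hN hf
  rw [Fintype.sum_bool] at this
  exact this

theorem aux_ideal
    {g : Type*} [LieRing g] [LieAlgebra ℝ g] [Module.Finite ℝ g]
    (hneg : ∀ x : g, x ≠ 0 → killingForm ℝ g x x < 0)
    (k : LieSubalgebra ℝ g)
    {nk : ℕ} (Z : Fin nk → g)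
    (hZk : ∀ j, Z j ∈ k)
    (hZon : ∀ j j' : Fin nk,
      -(killingForm ℝ g (Z j) (Z j')) = if j = j' then (1 : ℝ) else 0)
    (hZspan : Submodule.span ℝ (Set.range Z) = k.toSubmodule)
    (K : LieSubalgebra ℝ g) (c : ℝ)
    (hKk : K ≤ k)
    (hKideal : ∀ z ∈ k, ∀ w ∈ K, ⁅z, w⁆ ∈ K)
    (hc : ∀ z w : K, killingForm ℝ K z w = c * killingForm ℝ g (z : g) (w : g))
    (hm : ∀ j, ∀ x ∈ K.toSubmodule,
      (LieAlgebra.ad ℝ g (Z j) ∘ₗ LieAlgebra.ad ℝ g (Z j)) x ∈ K.toSubmodule) :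
    ∑ j, LinearMap.trace ℝ K.toSubmodule
      ((LieAlgebra.ad ℝ g (Z j) ∘ₗ LieAlgebra.ad ℝ g (Z j)).restrict (hm j)) =
      -(c * (Module.finrank ℝ K : ℝ)) := by
  have hB : (killingForm ℝ g).IsRefl := (LieModule.traceForm_isSymm ℝ g g).isRefl
  have hcompl := aux_isCompl (killingForm ℝ g) hB hneg K.toSubmodule
  let P := K.toSubmodule.projection _ hcompl
  have hPmem : ∀ x, P x ∈ K := fun x => Submodule.projection_apply_mem hcompl x
  have hPid : ∀ x ∈ K, P x = x := fun x hx => Submodule.projection_apply_of_mem_left hcompl hx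
  have hPorth : ∀ x, ∀ w ∈ K, killingForm ℝ g w (x - P x) = 0 := by
    intro x
    have : x - P x ∈ (killingForm ℝ g).orthogonal K.toSubmodule := by
      rw [← Submodule.projectionOnto_apply_eq_zero_iff hcompl]
      apply Subtype.ext
      change P (x - P x) = 0
      rw [map_sub, hPid _ (hPmem x), sub_self]
    exact this
  have hproj : LinearMap.IsProj K.toSubmodule P := ⟨hPmem, hPid⟩
  have htr := hproj.trace
  have hPk : ∀ x, P x ∈ k.toSubmodule := fun x => hKk (hPmem x)
  rw [← LinearMap.trace_restrict_eq_of_forall_mem k.toSubmodule P hPk,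
    aux_trace_basis (killingForm ℝ g) Z k.toSubmodule hZon hZspan P] at htr
  have key : ∀ j, LinearMap.trace ℝ K.toSubmodule
      ((LieAlgebra.ad ℝ g (Z j) ∘ₗ LieAlgebra.ad ℝ g (Z j)).restrict (hm j)) =
      c * killingForm ℝ g (P (Z j)) (Z j) := by
    intro j
    have hbr : ∀ w ∈ K, ⁅Z j, w⁆ = ⁅P (Z j), w⁆ := by
      intro w hw
      rw [← sub_eq_zero, ← sub_lie]
      by_contra h0
      have hlt := hneg _ h0
      set b := Z j - P (Z j) with hb
      have hbk : b ∈ k := sub_mem (hZk j) (hPk _)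
      have h1 : killingForm ℝ g ⁅b, w⁆ ⁅b, w⁆ = killingForm ℝ g b ⁅w, ⁅b, w⁆⁆ :=
        LieModule.traceForm_apply_lie_apply ℝ g g _ _ _
      have h2 : killingForm ℝ g b ⁅w, ⁅b, w⁆⁆ = 0 := by
        rw [killingForm, LieModule.traceForm_comm]
        exact hPorth (Z j) _ (K.lie_mem hw (hKideal b hbk w hw))
      linarith
    have h3 : killingForm ℝ g (P (Z j)) (Z j) = killingForm ℝ g (P (Z j)) (P (Z j)) := by
      have := hPorth (Z j) _ (hPmem (Z j))
      rw [map_sub] at this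
      linarith
    rw [h3]
    have h4 := hc ⟨P (Z j), hPmem _⟩ ⟨P (Z j), hPmem _⟩
    rw [killingForm_apply_apply] at h4
    rw [← h4]
    change LinearMap.trace ℝ K _ = _
    congr 1
    ext x
    change ⁅Z j, ⁅Z j, (x : g)⁆⁆ = ⁅P (Z j), ⁅P (Z j), (x : g)⁆⁆
    rw [hbr x x.2, hbr _ (K.lie_mem (hPmem _) x.2)]
  rw [Finset.sum_congr rfl fun j _ => key j, ← Finset.mul_sum]
  rw [Finset.sum_neg_distrib] at htr
  change _ = ((Module.finrank ℝ K : ℕ) : ℝ) at htr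
  rw [← htr]; ring

/-- In the setting of a compact semisimple real Lie algebra `g` with subalgebra
`k` and Killing-orthogonal complement `p` (with `[k,p] ⊆ p`), suppose `k = k₁ ⊕ ⋯ ⊕ k_s` is a
direct sum of ideals of `k` and the Killing form of each Lie algebra `k i` equals `c i` times the
restriction of the Killing form of `g`.  Then
`-∑ j tr_p((ad (Z j))|_p ∘ (ad (Z j))|_p) = ∑ i (1 - c i) · dim (k i)`. -/
theorem stmt4
    {g : Type*} [LieRing g] [LieAlgebra ℝ g] [Module.Finite ℝ g]
    (hneg : ∀ x : g, x ≠ 0 → killingForm ℝ g x x < 0)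
    (k : LieSubalgebra ℝ g) (p : Submodule ℝ g)
    (hp : ∀ x : g, x ∈ p ↔ ∀ z ∈ k, killingForm ℝ g x z = 0)
    (hkp : ∀ z ∈ k, ∀ x ∈ p, ⁅z, x⁆ ∈ p)
    (prk prp : g →ₗ[ℝ] g)
    (hprk : ∀ x : g, prk x ∈ k) (hprp : ∀ x : g, prp x ∈ p)
    (hsum : ∀ x : g, prk x + prp x = x)
    {nk np : ℕ} (Z : Fin nk → g) (X : Fin np → g)
    (hZk : ∀ j, Z j ∈ k) (hXp : ∀ i, X i ∈ p)
    (hZon : ∀ j j' : Fin nk,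
      -(killingForm ℝ g (Z j) (Z j')) = if j = j' then (1 : ℝ) else 0)
    (hXon : ∀ i i' : Fin np,
      -(killingForm ℝ g (X i) (X i')) = if i = i' then (1 : ℝ) else 0)
    (hZspan : Submodule.span ℝ (Set.range Z) = k.toSubmodule)
    (hXspan : Submodule.span ℝ (Set.range X) = p)
    {s : ℕ} (K : Fin s → LieSubalgebra ℝ g) (c : Fin s → ℝ)
    (hKk : ∀ i, K i ≤ k)
    (hKideal : ∀ i, ∀ z ∈ k, ∀ w ∈ K i, ⁅z, w⁆ ∈ K i)
    (hKindep : iSupIndep fun i => (K i).toSubmodule)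
    (hKsup : (⨆ i, (K i).toSubmodule) = k.toSubmodule)
    (hc : ∀ i, ∀ z w : K i,
      killingForm ℝ (K i) z w = c i * killingForm ℝ g (z : g) (w : g)) :
    -(∑ j, LinearMap.trace ℝ p
        ((((LieAlgebra.ad ℝ g (Z j)).restrict
            (fun x hx => by rw [LieAlgebra.ad_apply]; exact hkp (Z j) (hZk j) x hx))) ∘ₗ
         (((LieAlgebra.ad ℝ g (Z j)).restrict
            (fun x hx => by rw [LieAlgebra.ad_apply]; exact hkp (Z j) (hZk j) x hx))))) =
      ∑ i, (1 - c i) * (Module.finrank ℝ (K i) : ℝ) := by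
  have hB : (killingForm ℝ g).IsRefl := (LieModule.traceForm_isSymm ℝ g g).isRefl
  have hpk : p = (killingForm ℝ g).orthogonal k.toSubmodule := by
    ext x
    rw [hp]
    refine forall₂_congr fun z _ => ?_
    rw [killingForm, LieModule.traceForm_comm]
  have hcompl : IsCompl k.toSubmodule p := by
    rw [hpk]; exact aux_isCompl (killingForm ℝ g) hB hneg k.toSubmodule
  let F : Fin nk → g →ₗ[ℝ] g := fun j => LieAlgebra.ad ℝ g (Z j) ∘ₗ LieAlgebra.ad ℝ g (Z j)
  have hFk : ∀ j, ∀ x ∈ k.toSubmodule, F j x ∈ k.toSubmodule := fun j x hx =>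
    k.lie_mem (hZk j) (k.lie_mem (hZk j) hx)
  have hFp : ∀ j, ∀ x ∈ p, F j x ∈ p := fun j x hx =>
    hkp _ (hZk j) _ (hkp _ (hZk j) _ hx)
  have hFK : ∀ i j, ∀ x ∈ (K i).toSubmodule, F j x ∈ (K i).toSubmodule := fun i j x hx =>
    hKideal i _ (hZk j) _ (hKideal i _ (hZk j) _ hx)
  have h1 : ∀ j, LinearMap.trace ℝ p ((F j).restrict (hFp j)) =
      -1 - ∑ i, LinearMap.trace ℝ (K i).toSubmodule ((F j).restrict (hFK i j)) := by
    intro j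
    have e1 := aux_trace_compl _ _ hcompl (F j) (hFk j) (hFp j)
    have e2 := hZon j j
    rw [if_pos rfl, killingForm_apply_apply] at e2
    have e3 := LinearMap.trace_eq_sum_trace_restrict_of_eq_biSup Finset.univ
      (N := fun i => (K i).toSubmodule) (hKindep.comp Subtype.val_injective)
      (f := F j) (fun i => hFK i j) k.toSubmodule (by simp [hKsup]) (hFk j)
    change -(LinearMap.trace ℝ g (F j)) = 1 at e2
    rw [e3] at e1
    linarith
  have hnk : (nk : ℝ) = ∑ i, (Module.finrank ℝ (K i) : ℝ) := by
    have e1 := aux_trace_basis (killingForm ℝ g) Z k.toSubmodule hZon hZspan LinearMap.id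
      (fun x hx => hx)
    have e3 := LinearMap.trace_eq_sum_trace_restrict_of_eq_biSup Finset.univ
      (N := fun i => (K i).toSubmodule) (hKindep.comp Subtype.val_injective)
      (f := LinearMap.id) (fun i x hx => hx) k.toSubmodule (by simp [hKsup]) (fun x hx => hx)
    rw [e1] at e3
    have e4 : ∀ i, LinearMap.trace ℝ (K i).toSubmodule
        ((LinearMap.id : g →ₗ[ℝ] g).restrict (p := (K i).toSubmodule) (q := (K i).toSubmodule)
          (fun x hx => hx)) = (Module.finrank ℝ (K i) : ℝ) := fun i =>
      LinearMap.trace_id ℝ (K i).toSubmodule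
    rw [Finset.sum_congr rfl fun i _ => e4 i] at e3
    rw [← e3]
    simp [hZon]
  change -(∑ j, LinearMap.trace ℝ p ((F j).restrict (hFp j))) = _
  rw [Finset.sum_congr rfl fun j _ => h1 j, Finset.sum_sub_distrib, Finset.sum_comm,
    Finset.sum_congr rfl fun i _ => aux_ideal hneg k Z hZk hZon hZspan (K i) (c i) (hKk i)
      (hKideal i) (hc i) (hFK i)]
  simp only [Finset.sum_const, Finset.card_univ, Fintype.card_fin, Finset.sum_neg_distrib,
    sub_mul, Finset.sum_sub_distrib, one_mul, ← hnk, nsmul_eq_mul]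
  ring
end

section
/- Let B : k → k be a linear map that is symmetric with respect to ⟨·,·⟩ and satisfies B([Z,W]) = [Z, B(W)] for all Z, W ∈ k, and let B̄ : g → g be the linear extension of B that vanishes on p. Then the endomorphism C := −Σ_j [ad Z_j, [ad Z_j, B̄]] − Σ_i [ad X_i, [ad X_i, B̄]] of g (brackets of endomorphisms are commutators) maps k into k and p into p, and satisfies: (a) ⟨C(Z), W⟩ = −2 · tr_p(ad(B Z)|_p ∘ (ad W)|_p) for all Z, W ∈ k, where (ad Z)|_p is the restriction of ad Z to p and tr_p is the trace on End(p); (b) C(X) = −2 Σ_i [B(pr_k[X_i,X]), X_i] for all X ∈ p. -/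
theorem trace_onb_aux {V ι : Type*} [AddCommGroup V] [Module ℝ V] [Fintype ι] [DecidableEq ι]
    (φ : V → V →ₗ[ℝ] ℝ) (b : ι → V)
    (hon : ∀ i j, φ (b i) (b j) = if i = j then (1 : ℝ) else 0)
    (hspan : ⊤ ≤ Submodule.span ℝ (Set.range b)) (f : Module.End ℝ V) :
    LinearMap.trace ℝ V f = ∑ i, φ (b i) (f (b i)) := by
  have hli : LinearIndependent ℝ b := by
    rw [Fintype.linearIndependent_iff]
    intro c hc i
    have := congrArg (φ (b i)) hc
    simpa [hon] using this
  let bs := Module.Basis.mk hli hspan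
  have hrepr : ∀ v i, bs.repr v i = φ (b i) v := by
    intro v i
    have h := congrArg (φ (b i)) (bs.sum_repr v)
    simpa [bs, hon] using h
  rw [LinearMap.trace_eq_matrix_trace ℝ bs, Matrix.trace]
  refine Finset.sum_congr rfl fun i _ => ?_
  rw [Matrix.diag_apply, LinearMap.toMatrix_apply, hrepr]
  simp [bs]

/-- In the setting of a compact semisimple real Lie algebra `g` with subalgebra
`k` and Killing-orthogonal complement `p` (with `[k,p] ⊆ p`), let `Bb : g → g` be the extension by
zero on `p` of a `⟨·,·⟩`-symmetric, `ad k`-equivariant linear map `B : k → k`.  Then the operator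
`C = -∑ j [ad (Z j), [ad (Z j), Bb]] - ∑ i [ad (X i), [ad (X i), Bb]]` maps `k` into `k` and
`p` into `p`, and satisfies
(a) `⟨C Z, W⟩ = -2 tr_p(ad(B Z)|_p ∘ (ad W)|_p)` for `Z, W ∈ k`;
(b) `C X = -2 ∑ i [B(prk [X i, X]), X i]` for `X ∈ p`. -/
theorem stmt5
    {g : Type*} [LieRing g] [LieAlgebra ℝ g] [Module.Finite ℝ g]
    (hneg : ∀ x : g, x ≠ 0 → killingForm ℝ g x x < 0)
    (k : LieSubalgebra ℝ g) (p : Submodule ℝ g)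
    (hp : ∀ x : g, x ∈ p ↔ ∀ z ∈ k, killingForm ℝ g x z = 0)
    (hkp : ∀ z ∈ k, ∀ x ∈ p, ⁅z, x⁆ ∈ p)
    (prk prp : g →ₗ[ℝ] g)
    (hprk : ∀ x : g, prk x ∈ k) (hprp : ∀ x : g, prp x ∈ p)
    (hsum : ∀ x : g, prk x + prp x = x)
    {nk np : ℕ} (Z : Fin nk → g) (X : Fin np → g)
    (hZk : ∀ j, Z j ∈ k) (hXp : ∀ i, X i ∈ p)
    (hZon : ∀ j j' : Fin nk,
      -(killingForm ℝ g (Z j) (Z j')) = if j = j' then (1 : ℝ) else 0)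
    (hXon : ∀ i i' : Fin np,
      -(killingForm ℝ g (X i) (X i')) = if i = i' then (1 : ℝ) else 0)
    (hZspan : Submodule.span ℝ (Set.range Z) = k.toSubmodule)
    (hXspan : Submodule.span ℝ (Set.range X) = p)
    (Bb : Module.End ℝ g)
    (hBp : ∀ x ∈ p, Bb x = 0)
    (hBk : ∀ z ∈ k, Bb z ∈ k)
    (hBsymm : ∀ z ∈ k, ∀ w ∈ k,
      -(killingForm ℝ g (Bb z) w) = -(killingForm ℝ g z (Bb w)))
    (hBequiv : ∀ z ∈ k, ∀ w ∈ k, Bb ⁅z, w⁆ = ⁅z, Bb w⁆)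
    (C : Module.End ℝ g)
    (hC : C =
      -(∑ j, ⁅(LieAlgebra.ad ℝ g (Z j) : Module.End ℝ g),
              ⁅(LieAlgebra.ad ℝ g (Z j) : Module.End ℝ g), Bb⁆⁆) -
        ∑ i, ⁅(LieAlgebra.ad ℝ g (X i) : Module.End ℝ g),
              ⁅(LieAlgebra.ad ℝ g (X i) : Module.End ℝ g), Bb⁆⁆) :
    (∀ z ∈ k, C z ∈ k) ∧ (∀ x ∈ p, C x ∈ p) ∧
    (∀ (z : g) (hz : z ∈ k) (w : g) (hw : w ∈ k),
      -(killingForm ℝ g (C z) w) =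
        -2 * LinearMap.trace ℝ p
          (((LieAlgebra.ad ℝ g (Bb z)).restrict
              (fun x hx => by rw [LieAlgebra.ad_apply]; exact hkp (Bb z) (hBk z hz) x hx)) ∘ₗ
           ((LieAlgebra.ad ℝ g w).restrict
              (fun x hx => by rw [LieAlgebra.ad_apply]; exact hkp w hw x hx)))) ∧
    (∀ x ∈ p, C x = (-2 : ℝ) • ∑ i, ⁅Bb (prk ⁅X i, x⁆), X i⁆) := by
  have inv : ∀ x y z : g, killingForm ℝ g ⁅x, y⁆ z = -killingForm ℝ g y ⁅x, z⁆ := by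
    intro x y z
    rw [← lie_skew, map_neg, LinearMap.neg_apply]
    congr 1
    exact LieModule.traceForm_apply_lie_apply ℝ g g y x z
  have symm : ∀ x y : g, killingForm ℝ g x y = killingForm ℝ g y x := fun x y =>
    LieModule.traceForm_comm ℝ g g x y
  have keyid : ∀ e v y : g, killingForm ℝ g e ⁅v, ⁅y, e⁆⁆ = killingForm ℝ g ⁅e, ⁅e, v⁆⁆ y := by
    intro e v y
    have h1 := inv v e ⁅y, e⁆
    have h2 := inv e ⁅e, v⁆ y
    rw [← lie_skew e v, ← lie_skew e y] at h2
    rw [← lie_skew e v]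
    simp only [map_neg, LinearMap.neg_apply, neg_neg, lie_neg] at h1 h2 ⊢
    linarith
  -- trace over g
  have trg : ∀ f : Module.End ℝ g, LinearMap.trace ℝ g f =
      -(∑ j, killingForm ℝ g (Z j) (f (Z j))) - ∑ i, killingForm ℝ g (X i) (f (X i)) := by
    intro f
    have h := trace_onb_aux (fun v => -(killingForm ℝ g v)) (Sum.elim Z X) ?_ ?_ f
    · rw [h, Fintype.sum_sum_type]
      simp [sub_eq_add_neg]
    · rintro (i | i) (j | j)
      · simpa using hZon i j
      · have := (hp _).1 (hXp j) _ (hZk i)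
        simp [symm (Z i) (X j), this]
      · have := (hp _).1 (hXp i) _ (hZk j)
        simp [this]
      · simpa using hXon i j
    · intro x _
      rw [Set.Sum.elim_range, Submodule.span_union, hZspan, hXspan, ← hsum x]
      exact Submodule.add_mem_sup (hprk x) (hprp x)
  have cas : ∀ v : g, ∑ i, ⁅X i, ⁅X i, v⁆⁆ = -v - ∑ j, ⁅Z j, ⁅Z j, v⁆⁆ := by
    intro v
    have key : ∀ y, killingForm ℝ g (∑ i, ⁅X i, ⁅X i, v⁆⁆ + ∑ j, ⁅Z j, ⁅Z j, v⁆⁆ + v) y = 0 := by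
      intro y
      have h1 : killingForm ℝ g v y = _ := (LieModule.traceForm_apply_apply ℝ g g v y).trans (trg _)
      have h2 : ∀ e : g, killingForm ℝ g e ⁅v, ⁅y, e⁆⁆ = killingForm ℝ g ⁅e, ⁅e, v⁆⁆ y := by
        intro e
        exact keyid e v y
      simp only [LinearMap.comp_apply, LieModule.toEnd_apply_apply, h2] at h1
      simp only [map_add, map_sum, LinearMap.add_apply, LinearMap.sum_apply, h1]
      ring
    by_contra hne
    have h0 : ∑ i, ⁅X i, ⁅X i, v⁆⁆ + ∑ j, ⁅Z j, ⁅Z j, v⁆⁆ + v ≠ 0 := by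
      intro h
      apply hne
      rw [← sub_eq_zero, ← h]
      abel
    exact (hneg _ h0).ne (key _)
  have comm : ∀ z ∈ k, ∀ v, Bb ⁅z, v⁆ = ⁅z, Bb v⁆ := by
    intro z hz v
    rw [← hsum v, lie_add, map_add, map_add, hBequiv z hz _ (hprk v), hBp _ (hprp v),
      hBp _ (hkp z hz _ (hprp v))]
    simp
  have commS : ∀ v, ∑ i, Bb ⁅X i, ⁅X i, v⁆⁆ = ∑ i, ⁅X i, ⁅X i, Bb v⁆⁆ := by
    intro v
    rw [← map_sum, cas, cas, map_sub, map_neg, map_sum]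
    congr 1
    refine Finset.sum_congr rfl fun j _ => ?_
    rw [comm _ (hZk j), comm _ (hZk j)]
  have hCv : ∀ v, C v = (2 : ℝ) • ∑ i, ⁅X i, Bb ⁅X i, v⁆⁆ - (2 : ℝ) • ∑ i, ⁅X i, ⁅X i, Bb v⁆⁆ := by
    intro v
    have hz : ∀ j, ⁅(LieAlgebra.ad ℝ g (Z j) : Module.End ℝ g), Bb⁆ = 0 := by
      intro j
      ext v
      simp [Ring.lie_def, comm _ (hZk j)]
    have hx : ∀ i, ⁅(LieAlgebra.ad ℝ g (X i) : Module.End ℝ g),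
        ⁅(LieAlgebra.ad ℝ g (X i) : Module.End ℝ g), Bb⁆⁆ v =
        ⁅X i, ⁅X i, Bb v⁆⁆ + Bb ⁅X i, ⁅X i, v⁆⁆ - (2 : ℝ) • ⁅X i, Bb ⁅X i, v⁆⁆ := by
      intro i
      simp [Ring.lie_def, two_smul]
      abel
    have hz' : ∀ j, ⁅(LieAlgebra.ad ℝ g (Z j) : Module.End ℝ g),
        ⁅(LieAlgebra.ad ℝ g (Z j) : Module.End ℝ g), Bb⁆⁆ = 0 := by
      intro j
      rw [hz, Ring.lie_def, mul_zero, zero_mul, sub_zero]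
    rw [hC, LinearMap.sub_apply, LinearMap.neg_apply, LinearMap.sum_apply, LinearMap.sum_apply]
    simp only [hz', LinearMap.zero_apply, Finset.sum_const_zero, neg_zero, zero_sub, hx, Finset.sum_sub_distrib, Finset.sum_add_distrib, commS,
      ← Finset.smul_sum]
    module
  have hxk : ∀ x ∈ p, ∀ z ∈ k, ⁅x, z⁆ ∈ p := by
    intro x hx z hz
    rw [← lie_skew]
    exact p.neg_mem (hkp z hz x hx)
  have hCk : ∀ z ∈ k, C z = -((2 : ℝ) • ∑ i, ⁅X i, ⁅X i, Bb z⁆⁆) := by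
    intro z hz
    rw [hCv, Finset.sum_eq_zero, smul_zero, zero_sub]
    intro i _
    rw [hBp _ (hxk _ (hXp i) z hz), lie_zero]
  have hBpr : ∀ v, Bb (prk v) = Bb v := by
    intro v
    conv_rhs => rw [← hsum v, map_add, hBp _ (hprp v), add_zero]
  have hBmem : ∀ v, Bb v ∈ k := fun v => hBpr v ▸ hBk _ (hprk v)
  have hCp : ∀ x ∈ p, C x = (-2 : ℝ) • ∑ i, ⁅Bb (prk ⁅X i, x⁆), X i⁆ := by
    intro x hx
    rw [hCv, hBp x hx]
    simp only [lie_zero, Finset.sum_const_zero, smul_zero, sub_zero, hBpr]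
    rw [neg_smul, ← smul_neg, ← Finset.sum_neg_distrib]
    simp only [lie_skew]
  refine ⟨?_, ?_, ?_, hCp⟩
  · intro z hz
    rw [hCk z hz, cas]
    have hb := hBk z hz
    refine k.neg_mem (k.smul_mem _ (k.sub_mem (k.neg_mem hb) (sum_mem fun j _ => ?_)))
    exact k.lie_mem (hZk j) (k.lie_mem (hZk j) hb)
  · intro x hx
    rw [hCp x hx]
    exact p.smul_mem _ (p.sum_mem fun i _ => hkp _ (hBmem _) _ (hXp i))
  · intro z hz w hw
    rw [trace_onb_aux (fun v : p => -((killingForm ℝ g v).comp p.subtype)) (fun i => ⟨X i, hXp i⟩)]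
    · rw [hCk z hz]
      simp only [map_neg, map_smul, map_sum, LinearMap.neg_apply, LinearMap.smul_apply,
        LinearMap.sum_apply, smul_eq_mul, neg_neg, Finset.mul_sum]
      refine Finset.sum_congr rfl fun i _ => ?_
      have : killingForm ℝ g ⁅X i, ⁅X i, Bb z⁆⁆ w = killingForm ℝ g (X i) ⁅Bb z, ⁅w, X i⁆⁆ :=
        (keyid _ _ _).symm
      simp [this]
    · intro i j
      have := hXon i j
      simpa using this
    · rintro ⟨x, hx⟩ _
      have hx' := hx
      rw [← hXspan] at hx'
      rw [Submodule.mem_span_range_iff_exists_fun] at hx' ⊢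
      obtain ⟨c, hc⟩ := hx'
      refine ⟨c, Subtype.ext ?_⟩
      simpa using hc
end

section
/- Let A : p → p be a linear map that is symmetric with respect to ⟨·,·⟩ and commutes with (ad Z)|_p for every Z ∈ k, and let Ā : g → g be the linear extension of A that vanishes on k. Write ad_p(X) := pr_p ∘ (ad X)|_p ∈ End(p) for X ∈ p. Then the endomorphism C := −Σ_j [ad Z_j, [ad Z_j, Ā]] − Σ_i [ad X_i, [ad X_i, Ā]] of g (brackets of endomorphisms are commutators) satisfies: (a) C(Z) = −2 Σ_i [X_i, A([Z, X_i])] for all Z ∈ k; (b) pr_k(C(X)) = 2 Σ_i pr_k([X_i, A(pr_p[X_i, X])]) for all X ∈ p; (c) pr_p(C(X)) = −Σ_j ([Z_j,[Z_j, A(X)]] + A([Z_j,[Z_j,X]])) − Σ_i [ad_p(X_i), [ad_p(X_i), A]](X) for all X ∈ p. -/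
/-- In the setting of a compact semisimple real Lie algebra `g` with subalgebra
`k` and Killing-orthogonal complement `p` (with `[k,p] ⊆ p`), let `Ab : g → g` be the extension by
zero on `k` of a `⟨·,·⟩`-symmetric linear map `A : p → p` commuting with `(ad Z)|_p` for `Z ∈ k`.
Then the operator `C = -∑ j [ad (Z j), [ad (Z j), Ab]] - ∑ i [ad (X i), [ad (X i), Ab]]`
satisfies:
(a) `C Z = -2 ∑ i [X i, A [Z, X i]]` for `Z ∈ k`;
(b) `prk (C X) = 2 ∑ i prk [X i, A (prp [X i, X])]` for `X ∈ p`;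
(c) `prp (C X) = -∑ j ([Z j,[Z j, A X]] + A [Z j,[Z j, X]]) - ∑ i [ad_p (X i), [ad_p (X i), A]] X`
for `X ∈ p`, where `ad_p X = prp ∘ ad X`. -/
theorem stmt6
    {g : Type*} [LieRing g] [LieAlgebra ℝ g] [Module.Finite ℝ g]
    (hneg : ∀ x : g, x ≠ 0 → killingForm ℝ g x x < 0)
    (k : LieSubalgebra ℝ g) (p : Submodule ℝ g)
    (hp : ∀ x : g, x ∈ p ↔ ∀ z ∈ k, killingForm ℝ g x z = 0)
    (hkp : ∀ z ∈ k, ∀ x ∈ p, ⁅z, x⁆ ∈ p)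
    (prk prp : g →ₗ[ℝ] g)
    (hprk : ∀ x : g, prk x ∈ k) (hprp : ∀ x : g, prp x ∈ p)
    (hsum : ∀ x : g, prk x + prp x = x)
    {nk np : ℕ} (Z : Fin nk → g) (X : Fin np → g)
    (hZk : ∀ j, Z j ∈ k) (hXp : ∀ i, X i ∈ p)
    (hZon : ∀ j j' : Fin nk,
      -(killingForm ℝ g (Z j) (Z j')) = if j = j' then (1 : ℝ) else 0)
    (hXon : ∀ i i' : Fin np,
      -(killingForm ℝ g (X i) (X i')) = if i = i' then (1 : ℝ) else 0)
    (hZspan : Submodule.span ℝ (Set.range Z) = k.toSubmodule)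
    (hXspan : Submodule.span ℝ (Set.range X) = p)
    (Ab : Module.End ℝ g)
    (hAk : ∀ z ∈ k, Ab z = 0)
    (hAp : ∀ x ∈ p, Ab x ∈ p)
    (hAsymm : ∀ x ∈ p, ∀ y ∈ p,
      -(killingForm ℝ g (Ab x) y) = -(killingForm ℝ g x (Ab y)))
    (hAcomm : ∀ z ∈ k, ∀ x ∈ p, Ab ⁅z, x⁆ = ⁅z, Ab x⁆)
    (C : Module.End ℝ g)
    (hC : C =
      -(∑ j, ⁅(LieAlgebra.ad ℝ g (Z j) : Module.End ℝ g),
              ⁅(LieAlgebra.ad ℝ g (Z j) : Module.End ℝ g), Ab⁆⁆) -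
        ∑ i, ⁅(LieAlgebra.ad ℝ g (X i) : Module.End ℝ g),
              ⁅(LieAlgebra.ad ℝ g (X i) : Module.End ℝ g), Ab⁆⁆) :
    (∀ z ∈ k, C z = (-2 : ℝ) • ∑ i, ⁅X i, Ab ⁅z, X i⁆⁆) ∧
    (∀ x ∈ p, prk (C x) = (2 : ℝ) • ∑ i, prk ⁅X i, Ab (prp ⁅X i, x⁆)⁆) ∧
    (∀ x ∈ p, prp (C x) =
      -(∑ j, (⁅Z j, ⁅Z j, Ab x⁆⁆ + Ab ⁅Z j, ⁅Z j, x⁆⁆)) -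
        ∑ i, (⁅(prp ∘ₗ (LieAlgebra.ad ℝ g (X i) : Module.End ℝ g) : Module.End ℝ g),
               ⁅(prp ∘ₗ (LieAlgebra.ad ℝ g (X i) : Module.End ℝ g) : Module.End ℝ g), Ab⁆⁆) x) := by
  have sym : ∀ a b : g, killingForm ℝ g a b = killingForm ℝ g b a := fun a b =>
    LieModule.traceForm_comm ℝ g g a b
  have inv : ∀ a b c : g, killingForm ℝ g ⁅a, b⁆ c = killingForm ℝ g a ⁅b, c⁆ := fun a b c =>
    LieModule.traceForm_apply_lie_apply ℝ g g a b c
  have pk : ∀ x ∈ p, ∀ z ∈ k, killingForm ℝ g x z = 0 := fun x hx => (hp x).1 hx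
  have kp0 : ∀ z ∈ k, ∀ x ∈ p, killingForm ℝ g z x = 0 := fun z hz x hx => by
    rw [sym]; exact pk x hx z hz
  have hpk : ∀ z ∈ k, ∀ x ∈ p, ⁅x, z⁆ ∈ p := fun z hz x hx => by
    rw [← lie_skew]; exact p.neg_mem (hkp z hz x hx)
  have nondeg : ∀ x : g, killingForm ℝ g x x = 0 → x = 0 := fun x h => by
    by_contra hx
    have := hneg x hx
    linarith
  have int0 : ∀ x ∈ k, x ∈ p → x = 0 := fun x hk hx => nondeg x (pk x hx x hk)
  have prk_p : ∀ x ∈ p, prk x = 0 := fun x hx => int0 _ (hprk x) (by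
    have : prk x = x - prp x := eq_sub_of_add_eq (hsum x)
    rw [this]; exact p.sub_mem hx (hprp x))
  have prp_p : ∀ x ∈ p, prp x = x := fun x hx => by
    have := hsum x
    rwa [prk_p x hx, zero_add] at this
  have mem_k : ∀ w : g, (∀ x ∈ p, killingForm ℝ g w x = 0) → w ∈ k := fun w hw => by
    have h1 := hw (prp w) (hprp w)
    have h2 : prp w = 0 := by
      apply nondeg
      nth_rewrite 1 [← hsum w] at h1
      rw [map_add, LinearMap.add_apply, kp0 _ (hprk w) _ (hprp w), zero_add] at h1
      exact h1
    have := hsum w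
    rw [h2, add_zero] at this
    rw [← this]; exact hprk w
  have expZ : ∀ y ∈ k, y = ∑ j, (-(killingForm ℝ g y (Z j))) • Z j := fun y hy => by
    have hy' : y ∈ Submodule.span ℝ (Set.range Z) := by rw [hZspan]; exact hy
    obtain ⟨c, rfl⟩ := (Submodule.mem_span_range_iff_exists_fun ℝ).1 hy'
    refine Finset.sum_congr rfl fun j _ => ?_
    congr 1
    have h1 : ∀ i, killingForm ℝ g (Z i) (Z j) = -(if i = j then (1 : ℝ) else 0) := fun i => by
      rw [← hZon]; ring
    simp [map_sum, LinearMap.sum_apply, h1]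
  have expX : ∀ y ∈ p, y = ∑ j, (-(killingForm ℝ g y (X j))) • X j := fun y hy => by
    have hy' : y ∈ Submodule.span ℝ (Set.range X) := by rw [hXspan]; exact hy
    obtain ⟨c, rfl⟩ := (Submodule.mem_span_range_iff_exists_fun ℝ).1 hy'
    refine Finset.sum_congr rfl fun j _ => ?_
    congr 1
    have h1 : ∀ i, killingForm ℝ g (X i) (X j) = -(if i = j then (1 : ℝ) else 0) := fun i => by
      rw [← hXon]; ring
    simp [map_sum, LinearMap.sum_apply, h1]
  have expG : ∀ y : g, y = ∑ j, (-(killingForm ℝ g (Z j) y)) • Z j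
      + ∑ i, (-(killingForm ℝ g (X i) y)) • X i := fun y => by
    have e1 := expZ _ (hprk y)
    have e2 := expX _ (hprp y)
    have h1 : ∀ j, killingForm ℝ g (Z j) y = killingForm ℝ g (prk y) (Z j) := fun j => by
      conv_lhs => rw [← hsum y]
      rw [map_add, kp0 _ (hZk j) _ (hprp y), add_zero, sym]
    have h2 : ∀ i, killingForm ℝ g (X i) y = killingForm ℝ g (prp y) (X i) := fun i => by
      conv_lhs => rw [← hsum y]
      rw [map_add, pk _ (hXp i) _ (hprk y), zero_add, sym]
    simp only [h1, h2]
    rw [← e1, ← e2, hsum]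
  have tr : ∀ f : Module.End ℝ g, LinearMap.trace ℝ g f =
      ∑ j, (-(killingForm ℝ g (Z j) (f (Z j)))) + ∑ i, (-(killingForm ℝ g (X i) (f (X i)))) := by
    intro f
    have hf : f = ∑ j, (-(killingForm ℝ g (Z j))).smulRight (f (Z j))
        + ∑ i, (-(killingForm ℝ g (X i))).smulRight (f (X i)) := by
      ext y
      conv_lhs => rw [expG y]
      simp [map_sum, LinearMap.sum_apply]
    conv_lhs => rw [hf]
    simp only [map_add, map_sum, LinearMap.trace_smulRight, LinearMap.neg_apply]
  -- the mixed terms of the Casimir operator vanish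
  have key : ∀ z ∈ k, ∀ x ∈ p, ∑ i, killingForm ℝ g ⁅X i, z⁆ ⁅X i, x⁆ = 0 := by
    intro z hz x hx
    have h0 : LinearMap.trace ℝ g (LieAlgebra.ad ℝ g z ∘ₗ LieAlgebra.ad ℝ g x) = 0 := by
      have := kp0 z hz x hx
      rwa [killingForm_apply_apply] at this
    rw [tr] at h0
    simp only [LinearMap.comp_apply, LieAlgebra.ad_apply] at h0
    have hZ0 : ∀ j, killingForm ℝ g (Z j) ⁅z, ⁅x, Z j⁆⁆ = 0 := fun j => by
      rw [← inv]
      exact kp0 _ (k.lie_mem (hZk j) hz) _ (hpk _ (hZk j) _ hx)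
    simp only [hZ0, neg_zero, Finset.sum_const_zero, zero_add] at h0
    rw [← h0]
    refine Finset.sum_congr rfl fun i _ => ?_
    rw [inv, ← lie_skew (X i) x, lie_neg, map_neg]
  have casK : ∀ z ∈ k, ∑ i, ⁅X i, ⁅X i, z⁆⁆ ∈ k := by
    intro z hz
    apply mem_k
    intro x hx
    rw [map_sum, LinearMap.sum_apply, ← neg_eq_zero, ← Finset.sum_neg_distrib, ← key z hz x hx]
    refine Finset.sum_congr rfl fun i _ => ?_
    rw [← lie_skew, map_neg, LinearMap.neg_apply, neg_neg, inv]
  have casP : ∀ x ∈ p, ∑ i, ⁅X i, ⁅X i, x⁆⁆ ∈ p := by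
    intro x hx
    rw [hp]
    intro z hz
    rw [map_sum, LinearMap.sum_apply, ← neg_eq_zero, ← Finset.sum_neg_distrib, ← key z hz x hx]
    refine Finset.sum_congr rfl fun i _ => ?_
    rw [← lie_skew, map_neg, LinearMap.neg_apply, neg_neg, inv, sym]
  have Lp : ∀ y, Ab (prp y) = Ab y := fun y => by
    conv_rhs => rw [← hsum y]
    rw [map_add, hAk _ (hprk y), zero_add]
  have Lin : ∀ y, Ab y ∈ p := fun y => by rw [← Lp]; exact hAp _ (hprp y)
  have comm0 : ∀ j, ⁅(LieAlgebra.ad ℝ g (Z j) : Module.End ℝ g), Ab⁆ = 0 := fun j => by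
    ext y
    rw [Ring.lie_def]
    simp only [LinearMap.sub_apply, Module.End.mul_apply, LieAlgebra.ad_apply,
      LinearMap.zero_apply]
    rw [← hsum y, lie_add, map_add, map_add, hAk _ (hprk y),
      hAk _ (k.lie_mem (hZk j) (hprk y)), hAcomm _ (hZk j) _ (hprp y)]
    simp
  have Cf : ∀ y, C y = -(∑ i, ⁅X i, ⁅X i, Ab y⁆⁆) + (2 : ℝ) • (∑ i, ⁅X i, Ab ⁅X i, y⁆⁆)
      - Ab (∑ i, ⁅X i, ⁅X i, y⁆⁆) := fun y => by
    have comm1 : ∀ j, ⁅(LieAlgebra.ad ℝ g (Z j) : Module.End ℝ g),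
        ⁅(LieAlgebra.ad ℝ g (Z j) : Module.End ℝ g), Ab⁆⁆ = 0 := fun j => by
      rw [comm0, Ring.lie_def, mul_zero, zero_mul, sub_zero]
    rw [hC]
    simp only [comm1, Finset.sum_const_zero, neg_zero, zero_sub, LinearMap.neg_apply,
      LinearMap.sum_apply]
    simp only [map_sum, Finset.smul_sum, ← Finset.sum_neg_distrib,
      ← Finset.sum_add_distrib, ← Finset.sum_sub_distrib]
    refine Finset.sum_congr rfl fun i _ => ?_
    simp only [Ring.lie_def, LinearMap.sub_apply, Module.End.mul_apply, LieAlgebra.ad_apply,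
      map_sub, lie_sub]
    module
  have mixed : ∀ y ∈ p, ∑ i, prp ⁅X i, prk ⁅X i, y⁆⁆ = ∑ j, ⁅Z j, ⁅Z j, y⁆⁆ := by
    intro y hy
    have e1 : ∀ i, prp ⁅X i, prk ⁅X i, y⁆⁆
        = ∑ j, (-(killingForm ℝ g ⁅y, Z j⁆ (X i))) • ⁅X i, Z j⁆ := fun i => by
      rw [prp_p _ (hpk _ (hprk _) _ (hXp i))]
      conv_lhs => rw [expZ _ (hprk ⁅X i, y⁆), lie_sum]
      refine Finset.sum_congr rfl fun j _ => ?_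
      rw [lie_smul]
      congr 2
      rw [sym ⁅y, Z j⁆, ← inv]
      conv_rhs => rw [← hsum ⁅X i, y⁆]
      rw [map_add, LinearMap.add_apply, pk _ (hprp _) _ (hZk j), add_zero]
    simp only [e1]
    rw [Finset.sum_comm]
    refine Finset.sum_congr rfl fun j _ => ?_
    have e2 := expX _ (hpk _ (hZk j) _ hy)
    have e3 : ⁅Z j, ⁅Z j, y⁆⁆ = ⁅⁅y, Z j⁆, Z j⁆ := by
      rw [← lie_skew (Z j) y, lie_neg, lie_skew]
    rw [e3]
    conv_rhs => rw [e2, sum_lie]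
    simp only [smul_lie]
  have split : ∀ y ∈ p, ∑ i, ⁅X i, ⁅X i, y⁆⁆
      = ∑ j, ⁅Z j, ⁅Z j, y⁆⁆ + ∑ i, prp ⁅X i, prp ⁅X i, y⁆⁆ := by
    intro y hy
    rw [← mixed y hy, ← Finset.sum_add_distrib]
    conv_lhs => rw [← prp_p _ (casP y hy), map_sum]
    refine Finset.sum_congr rfl fun i _ => ?_
    rw [← map_add, ← lie_add, hsum]
  refine ⟨fun z hz => ?_, fun x hx => ?_, fun x hx => ?_⟩
  · rw [Cf, hAk z hz, hAk _ (casK z hz)]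
    have : ∀ i, ⁅X i, Ab ⁅z, X i⁆⁆ = -⁅X i, Ab ⁅X i, z⁆⁆ := fun i => by
      rw [← lie_skew z, map_neg, lie_neg]
    simp only [this, Finset.sum_neg_distrib, lie_zero, Finset.sum_const_zero]
    module
  · rw [Cf, map_sub, map_add, map_neg, prk_p _ (casP _ (hAp x hx)), prk_p _ (Lin _), map_smul,
      map_sum]
    simp only [Lp]
    simp
  · rw [Cf, map_sub, map_add, map_neg, prp_p _ (casP _ (hAp x hx)), prp_p _ (Lin _), map_smul,
      map_sum, split _ (hAp x hx), split x hx]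
    have e : ∀ i, (⁅(prp ∘ₗ (LieAlgebra.ad ℝ g (X i) : Module.End ℝ g) : Module.End ℝ g),
        ⁅(prp ∘ₗ (LieAlgebra.ad ℝ g (X i) : Module.End ℝ g) : Module.End ℝ g), Ab⁆⁆) x
        = prp ⁅X i, prp ⁅X i, Ab x⁆⁆ - (2 : ℝ) • prp ⁅X i, Ab ⁅X i, x⁆⁆
          + Ab (prp ⁅X i, prp ⁅X i, x⁆⁆) := fun i => by
      simp only [Ring.lie_def, LinearMap.sub_apply, Module.End.mul_apply, LinearMap.comp_apply,
        LieAlgebra.ad_apply, map_sub, lie_sub]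
      rw [Lp ⁅X i, x⁆]
      module
    simp only [e, Finset.sum_add_distrib, Finset.sum_sub_distrib, map_add, map_sum,
      ← Finset.smul_sum]
    module
end

section
/- If a ≤ 9b, then x = 1 is the unique critical point of S on (0,∞) (that is, for x > 0 one has S'(x) = 0 if and only if x = 1), and S(x) < S(1) for every x ∈ (0,∞) with x ≠ 1; in particular S attains a strict global maximum on (0,∞) at x = 1. -/
/-- Let `0 < b < a` and `S x = a (x + 1/x) - b (x³ + 1/x³)` on `(0,∞)`.
If `a ≤ 9b`, then `x = 1` is the unique critical point of `S` on `(0,∞)` and `S` attains a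
strict global maximum on `(0,∞)` at `x = 1`. -/
theorem stmt7 (a b : ℝ) (hb : 0 < b) (hba : b < a) (h : a ≤ 9 * b)
    (S : ℝ → ℝ)
    (hS : ∀ x : ℝ, 0 < x → S x = a * (x + 1 / x) - b * (x ^ 3 + 1 / x ^ 3)) :
    (∀ x : ℝ, 0 < x → (deriv S x = 0 ↔ x = 1)) ∧
    (∀ x : ℝ, 0 < x → x ≠ 1 → S x < S 1) := by
  constructor
  · intro x hx
    have hx0 : x ≠ 0 := hx.ne'
    have hev : S =ᶠ[nhds x] fun y => a * (y + y⁻¹) - b * (y ^ 3 + (y ^ 3)⁻¹) := by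
      filter_upwards [lt_mem_nhds hx] with y hy
      rw [hS y hy, one_div, one_div]
    have h1 := hasDerivAt_inv hx0
    have h2 := hasDerivAt_pow 3 x
    have h3 := h2.fun_inv (pow_ne_zero 3 hx0)
    have h4 := (((hasDerivAt_id' x).fun_add h1).const_mul a).fun_sub
      ((h2.fun_add h3).const_mul b)
    have h5 : deriv S x = (x ^ 2 - 1) * (a * x ^ 2 - 3 * b * (x ^ 4 + x ^ 2 + 1)) / x ^ 4 := by
      rw [hev.deriv_eq, h4.deriv]
      push_cast
      field_simp
      ring
    rw [h5]
    constructor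
    · intro h0
      have h6 : (x ^ 2 - 1) * (a * x ^ 2 - 3 * b * (x ^ 4 + x ^ 2 + 1)) = 0 := by
        rcases div_eq_zero_iff.mp h0 with h | h
        · exact h
        · exact absurd h (pow_ne_zero 4 hx0)
      have h7 : x ^ 2 - 1 = 0 := by
        rcases mul_eq_zero.mp h6 with h7 | h7
        · exact h7
        · by_contra hne
          have hpos : 0 < (x ^ 2 - 1) ^ 2 := by positivity
          have h8 := mul_pos hb hpos
          have h9 := mul_le_mul_of_nonneg_right h (sq_nonneg x)
          nlinarith
      nlinarith
    · rintro rfl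
      norm_num
  · intro x hx hx1
    rw [hS x hx, hS 1 one_pos]
    have hx0 : x ≠ 0 := hx.ne'
    obtain ⟨t, ht⟩ : ∃ t, t = x + 1 / x := ⟨_, rfl⟩
    have ht2 : 0 < t - 2 := by
      have e : t - 2 = (x - 1) ^ 2 / x := by
        rw [ht]
        field_simp
        ring
      have hne : x - 1 ≠ 0 := sub_ne_zero.mpr hx1
      rw [e]
      positivity
    have h3 : x ^ 3 + 1 / x ^ 3 = t ^ 3 - 3 * t := by
      rw [ht]
      field_simp
      ring
    rw [h3, ← ht]
    have h4 : 0 < b * (t + 1) ^ 2 - a := by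
      have h5 : 9 < (t + 1) ^ 2 := by nlinarith
      nlinarith [mul_lt_mul_of_pos_left h5 hb]
    have h6 := mul_pos ht2 h4
    norm_num
    nlinarith
end

section
/- If a > 9b, then there exists x₂ > 1 such that the set of critical points of S on (0,∞) is exactly {1/x₂, 1, x₂}; S has a strict local minimum at x = 1; S has strict local maxima at x = 1/x₂ and x = x₂; and S(x) ≤ S(x₂) = S(1/x₂) for all x ∈ (0,∞), so the global maximum of S is attained at x₂ and at 1/x₂. -/
/-- Let `0 < b < a` and `S x = a (x + 1/x) - b (x³ + 1/x³)` on `(0,∞)`.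
If `a > 9b`, then there exists `x₂ > 1` such that the critical points of `S` on `(0,∞)` are
exactly `1/x₂`, `1`, `x₂`; `S` has a strict local minimum at `1` and strict local maxima at
`x₂` and `1/x₂`; and `S x ≤ S x₂ = S (1/x₂)` for all `x > 0`, so the global maximum of `S` is
attained at `x₂` and `1/x₂`. -/
theorem stmt8 (a b : ℝ) (hb : 0 < b) (hba : b < a) (h : 9 * b < a)
    (S : ℝ → ℝ)
    (hS : ∀ x : ℝ, 0 < x → S x = a * (x + 1 / x) - b * (x ^ 3 + 1 / x ^ 3)) :
    ∃ x₂ : ℝ, 1 < x₂ ∧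
      (∀ x : ℝ, 0 < x → (deriv S x = 0 ↔ (x = 1 / x₂ ∨ x = 1 ∨ x = x₂))) ∧
      (∃ ε > 0, ∀ y : ℝ, |y - 1| < ε → y ≠ 1 → S 1 < S y) ∧
      (∃ ε > 0, ∀ y : ℝ, |y - x₂| < ε → y ≠ x₂ → S y < S x₂) ∧
      (∃ ε > 0, ∀ y : ℝ, |y - 1 / x₂| < ε → y ≠ 1 / x₂ → S y < S (1 / x₂)) ∧
      (∀ x : ℝ, 0 < x → S x ≤ S x₂) ∧ S x₂ = S (1 / x₂) := by
  obtain ⟨u, v, hu, hv0, huv, ha⟩ : ∃ u v : ℝ, 1 < u ∧ 0 < v ∧ u * v = 1 ∧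
      a + 3 * b = 3 * b * (u + v) ^ 2 := by
    have h4 : 4 < (a + 3 * b) / (3 * b) := by
      rw [lt_div_iff₀ (by positivity)]; linarith
    set q := (a + 3 * b) / (3 * b) with hq
    have hqe : a + 3 * b = 3 * b * q := by rw [hq]; field_simp
    have h1 : √q ^ 2 = q := Real.sq_sqrt (by linarith)
    have h2 : √(q - 4) ^ 2 = q - 4 := Real.sq_sqrt (by linarith)
    have h3 : 2 < √q := Real.lt_sqrt_of_sq_lt (by linarith)
    have h5 : 0 ≤ √(q - 4) := Real.sqrt_nonneg _
    refine ⟨(√q + √(q - 4)) / 2, (√q - √(q - 4)) / 2, by linarith, ?_, by nlinarith, ?_⟩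
    · nlinarith
    · rw [hqe]; ring_nf; rw [h1]
  have hv1 : v < 1 := by nlinarith
  have hvu : 1 / u = v := by field_simp; linarith
  have hSt : ∀ x : ℝ, 0 < x → S x = b * (3 * (u + v) ^ 2 * (x + 1 / x) - (x + 1 / x) ^ 3) := by
    intro x hx
    have ha' : a = 3 * b * (u + v) ^ 2 - 3 * b := by linarith
    rw [hS x hx, ha']; field_simp; ring
  have hSu : S u = b * (2 * (u + v) ^ 3) := by
    rw [hSt u (by linarith), hvu]; ring
  have hSv : S v = b * (2 * (u + v) ^ 3) := by
    have : 1 / v = u := by field_simp; linarith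
    rw [hSt v hv0, this]; ring
  have htx : ∀ x : ℝ, 0 < x → (x + 1 / x) - (u + v) = (x - u) * (x - v) / x := by
    intro x hx
    have : (x - u) * (x - v) = x ^ 2 - (u + v) * x + 1 := by rw [← huv]; ring
    rw [this]; field_simp; ring
  have hdiff : ∀ x : ℝ, 0 < x → b * (2 * (u + v) ^ 3) - S x
      = b * ((x - u) * (x - v) / x) ^ 2 * ((x + 1 / x) + 2 * (u + v)) := by
    intro x hx
    rw [← htx x hx, hSt x hx]; ring
  have hlt : ∀ x : ℝ, 0 < x → x ≠ u → x ≠ v → S x < b * (2 * (u + v) ^ 3) := by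
    intro x hx h1 h2
    have h1' := sub_ne_zero.2 h1
    have h2' := sub_ne_zero.2 h2
    have := hdiff x hx
    have h3 : 0 < b * ((x - u) * (x - v) / x) ^ 2 * ((x + 1 / x) + 2 * (u + v)) := by positivity
    linarith
  refine ⟨u, hu, ?_, ?_, ?_, ?_, ?_, ?_⟩
  · intro x hx
    rw [hvu]
    have hd : HasDerivAt S (b * (3 * (u + v) ^ 2 * (1 + -(x ^ 2)⁻¹)
        - 3 * (x + x⁻¹) ^ 2 * (1 + -(x ^ 2)⁻¹))) x := by
      have h1 : HasDerivAt (fun y : ℝ => y + y⁻¹) (1 + -(x ^ 2)⁻¹) x :=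
        (hasDerivAt_id x).add (hasDerivAt_inv hx.ne')
      have h2 := ((h1.const_mul (3 * (u + v) ^ 2)).sub (h1.pow 3)).const_mul b
      have h3 := h2.congr_of_eventuallyEq (f₁ := S) (by
        filter_upwards [lt_mem_nhds hx] with y hy
        rw [hSt y hy]; simp)
      exact h3.congr_deriv (by norm_num)
    rw [hd.deriv]
    have e : b * (3 * (u + v) ^ 2 * (1 + -(x ^ 2)⁻¹) - 3 * (x + x⁻¹) ^ 2 * (1 + -(x ^ 2)⁻¹))
        = -(3 * b * ((x + 1) * ((x + 1 / x) + (u + v)) / x ^ 3)) * ((x - v) * ((x - 1) * (x - u))) := by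
      have e1 : b * (3 * (u + v) ^ 2 * (1 + -(x ^ 2)⁻¹) - 3 * (x + x⁻¹) ^ 2 * (1 + -(x ^ 2)⁻¹))
        = -(3 * b * ((x + 1 / x) - (u + v)) * ((x + 1 / x) + (u + v)) * ((x + 1) * (x - 1) / x ^ 2)) := by
        field_simp; ring
      rw [e1, htx x hx]; field_simp
    rw [e]
    have hne : -(3 * b * ((x + 1) * ((x + 1 / x) + (u + v)) / x ^ 3)) ≠ 0 := by
      apply neg_ne_zero.2; positivity
    simp only [mul_eq_zero, hne, false_or, sub_eq_zero]
  · refine ⟨1 - v, by linarith, fun y hy hy1 => ?_⟩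
    rw [abs_lt] at hy
    have hy0 : 0 < y := by linarith
    have hyu : y < u := by nlinarith
    have h1 := htx y hy0
    have h2 : (y - u) * (y - v) / y < 0 :=
      div_neg_of_neg_of_pos (mul_neg_of_neg_of_pos (by linarith) (by linarith)) hy0
    have h3 : 2 < y + 1 / y := by
      have h31 : y + 1 / y - 2 = (y - 1) ^ 2 / y := by field_simp; ring
      have h32 := sub_ne_zero.2 hy1
      have h33 : 0 < (y - 1) ^ 2 / y := by positivity
      linarith
    have h4 : y + 1 / y < u + v := by linarith
    rw [hSt y hy0, hSt 1 one_pos]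
    apply mul_lt_mul_of_pos_left _ hb
    generalize y + 1 / y = t at *
    generalize u + v = w at *
    have h5 : 0 < (t - 2) * (3 * w ^ 2 - t ^ 2 - 2 * t - 4) :=
      mul_pos (by linarith) (by nlinarith)
    norm_num
    nlinarith
  · refine ⟨u - 1, by linarith, fun y hy hy1 => ?_⟩
    rw [abs_lt] at hy
    rw [hSu]
    exact hlt y (by linarith) hy1 (by linarith : v < y).ne'
  · rw [hvu]
    refine ⟨min v (1 - v), lt_min hv0 (by linarith), fun y hy hy1 => ?_⟩
    rw [lt_min_iff, abs_lt, abs_lt] at hy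
    rw [hSv]
    exact hlt y (by linarith) (by linarith : y < u).ne hy1
  · intro x hx
    rw [hSu]
    have := hdiff x hx
    have h3 : 0 ≤ b * ((x - u) * (x - v) / x) ^ 2 * ((x + 1 / x) + 2 * (u + v)) := by positivity
    linarith
  · rw [hvu, hSu, hSv]
end

section
/- For every integer n ≥ 4, the characteristic polynomial of L equals X · (X − n/(2(n−1)))^{n−1} · (X − 1)^{n(n−3)/2} · (X − (n−2)/(n−1))^{n(n−1)/2}. (Hence the Lichnerowicz Laplacian of the standard Einstein metric on SO(2n)/Tⁿ restricted to invariant symmetric 2-tensors has eigenvalues 0, n/(2(n−1)), 1, (n−2)/(n−1) with multiplicities 1, n−1, n(n−3)/2, n(n−1)/2.) -/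
open Polynomial

namespace LichAux

abbrev S (n : ℕ) := {s : Finset (Fin n) // s.card = 2}

/-- incidence matrix of 2-subsets and points -/
def N (n : ℕ) : Matrix (S n) (Fin n) ℚ := fun s i => if i ∈ s.1 then 1 else 0

/-- projection matrix from pairs to 2-subsets -/
def U (n : ℕ) : Matrix (S n × Fin 2) (S n) ℚ := fun p s => if p.1 = s then 1 else 0

lemma charpoly_add_scalar {m : Type*} [Fintype m] [DecidableEq m] (M : Matrix m m ℚ) (a : ℚ) :
    (M + Matrix.scalar m a).charpoly = M.charpoly.comp (X - C a) := by
  have h := Matrix.charpoly_sub_scalar M (-a)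
  rw [map_neg, sub_neg_eq_add, C_neg, ← sub_eq_add_neg] at h
  exact h

lemma card_S (n : ℕ) : Fintype.card (S n) = n.choose 2 := by
  simp [S]

lemma NNt (n : ℕ) (s t : S n) : (N n * (N n).transpose) s t = ((s.1 ∩ t.1).card : ℚ) := by
  simp [N, Matrix.mul_apply, ← ite_and, Finset.inter_comm, ← Finset.mem_inter]

lemma offdiag (n : ℕ) (i j : Fin n) (h : i ≠ j) : ((N n).transpose * N n) i j = 1 := by
  rw [Matrix.mul_apply, Finset.sum_eq_single (⟨{i, j}, Finset.card_pair h⟩ : S n)]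
  · simp [N]
  · intro s _ hs
    by_contra hne
    apply hs
    have hi : i ∈ s.1 := by
      by_contra hi; apply hne; simp [N, hi]
    have hj : j ∈ s.1 := by
      by_contra hj; apply hne; simp [N, hj]
    apply Subtype.ext
    symm
    apply Finset.eq_of_subset_of_card_le
    · intro x hx
      simp only [Finset.mem_insert, Finset.mem_singleton] at hx
      rcases hx with rfl | rfl <;> assumption
    · rw [s.2, Finset.card_pair h]
  · simp

lemma diag (n : ℕ) (i : Fin n) : ((N n).transpose * N n) i i = (n : ℚ) - 1 := by
  have h1 : ∑ j, ((N n).transpose * N n) i j = 2 * ((N n).transpose * N n) i i := by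
    simp only [Matrix.mul_apply]
    rw [Finset.sum_comm, Finset.mul_sum]
    refine Finset.sum_congr rfl fun s _ => ?_
    rw [← Finset.mul_sum]
    have : ∑ j, N n s j = 2 := by
      simp [N, s.2]
    rw [this]
    by_cases hi : i ∈ s.1 <;> simp [N, hi]
  have h2 : ∑ j, ((N n).transpose * N n) i j = ((N n).transpose * N n) i i + ((n : ℚ) - 1) := by
    rw [← Finset.add_sum_erase _ _ (Finset.mem_univ i),
      Finset.sum_congr rfl (fun j hj => offdiag n i j (Finset.ne_of_mem_erase hj).symm)]
    have : 1 ≤ n := by have := i.2; omega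
    simp [Nat.cast_sub this]
  linarith

lemma NtN (n : ℕ) (k : ℚ) : k • ((N n).transpose * N n) =
    Matrix.vecMulVec (fun _ => k) (fun _ => 1) + Matrix.scalar (Fin n) (k * ((n : ℚ) - 2)) := by
  ext i j
  by_cases h : i = j
  · subst h
    simp only [Matrix.smul_apply, diag, Matrix.add_apply, Matrix.vecMulVec_apply,
      Matrix.scalar_apply, Matrix.diagonal_apply_eq, smul_eq_mul]
    ring
  · simp [Matrix.smul_apply, offdiag n i j h, Matrix.vecMulVec_apply, h]

lemma charpoly_NtN (n : ℕ) (hn : 1 ≤ n) (k : ℚ) : (k • ((N n).transpose * N n)).charpoly =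
    (X - C (k * ((n : ℚ) - 2))) ^ (n - 1) * (X - C (k * (2 * (n : ℚ) - 2))) := by
  rw [NtN, charpoly_add_scalar, Matrix.charpoly_vecMulVec]
  obtain ⟨m, rfl⟩ : ∃ m, n = m + 1 := ⟨n - 1, by omega⟩
  have hC : (C 2 : ℚ[X]) = 2 := rfl
  simp [dotProduct, smul_eq_C_mul, pow_succ, hC]
  ring

lemma charpoly_NNt (n : ℕ) (hn : 3 ≤ n) (k : ℚ) : (k • (N n * (N n).transpose)).charpoly =
    X ^ (n.choose 2 - n) *
    ((X - C (k * ((n : ℚ) - 2))) ^ (n - 1) * (X - C (k * (2 * (n : ℚ) - 2)))) := by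
  have hle : n ≤ n.choose 2 := by
    rw [Nat.choose_two_right, Nat.le_div_iff_mul_le (by norm_num)]
    exact Nat.mul_le_mul_left _ (by omega)
  rw [← Matrix.mul_smul, Matrix.charpoly_mul_comm_of_le _ _ (by simpa [card_S] using hle),
    Matrix.smul_mul, charpoly_NtN n (by omega), card_S, Fintype.card_fin]

lemma UtU (n : ℕ) : (U n).transpose * U n = (2 : ℚ) • (1 : Matrix (S n) (S n) ℚ) := by
  ext s t
  rw [Matrix.mul_apply, Fintype.sum_prod_type]
  by_cases h : s = t
  · subst h
    simp [U]
  · simp [U, h, Ne.symm h]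

lemma UMU (n : ℕ) (M : Matrix (S n) (S n) ℚ) (p q : S n × Fin 2) :
    (U n * (M * (U n).transpose)) p q = M p.1 q.1 := by
  simp [U, Matrix.mul_apply]

lemma charpoly_UMU (n : ℕ) (M : Matrix (S n) (S n) ℚ) :
    (U n * (M * (U n).transpose)).charpoly = X ^ (n.choose 2) * ((2 : ℚ) • M).charpoly := by
  rw [Matrix.charpoly_mul_comm_of_le _ _ (by simp only [Fintype.card_prod, Fintype.card_fin]; omega), Matrix.mul_assoc, UtU,
    Matrix.mul_smul, Matrix.mul_one, Fintype.card_prod, card_S, Fintype.card_fin]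
  congr 2
  omega

end LichAux

/-- For `n ≥ 4`, the matrix of the Lichnerowicz Laplacian of the standard
Einstein metric on `SO(2n)/Tⁿ`, indexed by pairs `(s, ε)` with `s` a 2-element subset of
`{1,…,n}` and `ε ∈ {1,2}`, has characteristic polynomial
`X (X - n/(2(n-1)))^(n-1) (X - 1)^(n(n-3)/2) (X - (n-2)/(n-1))^(n(n-1)/2)`. -/
theorem stmt9 (n : ℕ) (hn : 4 ≤ n)
    (L : Matrix ({s : Finset (Fin n) // s.card = 2} × Fin 2)
          ({s : Finset (Fin n) // s.card = 2} × Fin 2) ℚ)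
    (hL : ∀ p q, L p q =
      if p = q then ((n : ℚ) - 2) / ((n : ℚ) - 1)
      else if (p.1.1 ∩ q.1.1).card = 1 then -1 / (4 * ((n : ℚ) - 1))
      else 0) :
    L.charpoly =
      X * (X - C ((n : ℚ) / (2 * ((n : ℚ) - 1)))) ^ (n - 1) *
        (X - C 1) ^ (n * (n - 3) / 2) *
        (X - C (((n : ℚ) - 2) / ((n : ℚ) - 1))) ^ (n * (n - 1) / 2) := by
  have hn1 : (n : ℚ) - 1 ≠ 0 := by
    have : (4 : ℚ) ≤ n := by exact_mod_cast hn
    intro h; linarith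
  have hdec : L = LichAux.U n * (((-1 / (4 * ((n : ℚ) - 1))) •
      (LichAux.N n * (LichAux.N n).transpose) +
        Matrix.scalar _ (1 / (2 * ((n : ℚ) - 1)))) * (LichAux.U n).transpose) +
      Matrix.scalar _ (((n : ℚ) - 2) / ((n : ℚ) - 1)) := by
    ext p q
    rw [hL, Matrix.add_apply, LichAux.UMU, Matrix.add_apply, Matrix.smul_apply, LichAux.NNt]
    simp only [Matrix.scalar_apply, Matrix.diagonal_apply, smul_eq_mul]
    by_cases h1 : p.1 = q.1
    · have hc : (p.1.1 ∩ q.1.1).card = 2 := by rw [h1, Finset.inter_self, q.1.2]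
      rw [hc]
      by_cases h : p = q
      · simp only [h, if_true]
        field_simp
        push_cast
        ring
      · simp only [h, h1, if_true, if_false]
        norm_num
        field_simp
        norm_num
    · have h : p ≠ q := fun h => h1 (by rw [h])
      have hlt : (p.1.1 ∩ q.1.1).card < 2 := by
        by_contra hge
        apply h1
        have e1 : p.1.1 ∩ q.1.1 = p.1.1 :=
          Finset.eq_of_subset_of_card_le Finset.inter_subset_left (by rw [p.1.2]; omega)
        have e2 : p.1.1 ∩ q.1.1 = q.1.1 :=
          Finset.eq_of_subset_of_card_le Finset.inter_subset_right (by rw [q.1.2]; omega)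
        exact Subtype.ext (e1.symm.trans e2)
      simp only [h, h1, if_false]
      generalize (p.1.1 ∩ q.1.1).card = c at hlt
      interval_cases c <;> simp
  have hs : (2 : ℚ) • ((-1 / (4 * ((n : ℚ) - 1))) •
      (LichAux.N n * (LichAux.N n).transpose) +
        Matrix.scalar _ (1 / (2 * ((n : ℚ) - 1)))) =
      (-1 / (2 * ((n : ℚ) - 1))) • (LichAux.N n * (LichAux.N n).transpose) +
        Matrix.scalar _ (1 / ((n : ℚ) - 1)) := by
    ext s t
    simp only [Matrix.scalar_apply, Matrix.diagonal_apply, smul_eq_mul, Matrix.smul_apply,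
      Matrix.add_apply]
    split_ifs <;> field_simp <;> ring
  have hch : n.choose 2 - n = n * (n - 3) / 2 := by
    rw [Nat.choose_two_right]
    obtain ⟨m, rfl⟩ : ∃ m, n = m + 3 := ⟨n - 3, by omega⟩
    have : (m + 3) * (m + 3 - 1) = (m + 3) * (m + 3 - 3) + 2 * (m + 3) := by
      simp only [Nat.add_sub_cancel, Nat.add_succ_sub_one]; ring
    rw [this]
    omega
  rw [hdec, LichAux.charpoly_add_scalar, LichAux.charpoly_UMU, hs, LichAux.charpoly_add_scalar,
    LichAux.charpoly_NNt n (by omega), hch, Nat.choose_two_right]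
  simp only [mul_comp, pow_comp, sub_comp, X_comp, C_comp, sub_sub, ← C_add]
  have e1 : ((n : ℚ) - 2) / ((n : ℚ) - 1) + 1 / ((n : ℚ) - 1) = 1 := by
    field_simp; ring
  have e2 : ((n : ℚ) - 2) / ((n : ℚ) - 1) + (1 / ((n : ℚ) - 1) +
      -1 / (2 * ((n : ℚ) - 1)) * ((n : ℚ) - 2)) = (n : ℚ) / (2 * ((n : ℚ) - 1)) := by
    field_simp; ring
  have e3 : ((n : ℚ) - 2) / ((n : ℚ) - 1) + (1 / ((n : ℚ) - 1) +
      -1 / (2 * ((n : ℚ) - 1)) * (2 * (n : ℚ) - 2)) = 0 := by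
    field_simp; ring
  rw [e1, e2, e3, C_0, sub_zero]
  ring
end

section
/- The characteristic polynomial of L equals X · (X − 1/2)³ · (X − 3/4)². (Hence the Lichnerowicz Laplacian of the standard Einstein metric on SO(6)/T³ restricted to invariant symmetric 2-tensors has eigenvalues 0, 1/2, 3/4 with multiplicities 1, 3, 2.) -/
open Polynomial

/-- Enumeration of the index set. -/
def idx10 : Fin 6 → {s : Finset (Fin 3) // s.card = 2} × Fin 2 :=
  ![(⟨{0, 1}, by decide⟩, 0), (⟨{0, 1}, by decide⟩, 1), (⟨{0, 2}, by decide⟩, 0),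
    (⟨{0, 2}, by decide⟩, 1), (⟨{1, 2}, by decide⟩, 0), (⟨{1, 2}, by decide⟩, 1)]

theorem idx10_bij : Function.Bijective idx10 := by
  constructor
  · decide
  · decide

/-- Columns are eigenvectors. -/
def P10 : Matrix (Fin 6) (Fin 6) ℚ :=
  !![1, 1, 0, 0, 1, 1; 1, -1, 0, 0, 1, 1; 1, 0, 1, 0, -1, 0;
     1, 0, -1, 0, -1, 0; 1, 0, 0, 1, 0, -1; 1, 0, 0, -1, 0, -1]

/-- The inverse of `P10`. -/
def Q10 : Matrix (Fin 6) (Fin 6) ℚ :=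
  !![1/6, 1/6, 1/6, 1/6, 1/6, 1/6; 1/2, -1/2, 0, 0, 0, 0; 0, 0, 1/2, -1/2, 0, 0;
     0, 0, 0, 0, 1/2, -1/2; 1/6, 1/6, -1/3, -1/3, 1/6, 1/6; 1/6, 1/6, 1/6, 1/6, -1/3, -1/3]

/-- The eigenvalues. -/
def d10 : Fin 6 → ℚ := ![0, 1/2, 1/2, 1/2, 3/4, 3/4]

theorem QP10 : Q10 * P10 = 1 := by
  ext i j
  fin_cases i <;> fin_cases j <;>
    simp [Q10, P10, Matrix.mul_apply, Fin.sum_univ_succ] <;> norm_num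

theorem idx10_same (i j : Fin 6) :
    (((idx10 i).1 = (idx10 j).1) ↔ i.val / 2 = j.val / 2) ∧
    (((idx10 i).2 = (idx10 j).2) ↔ i.val % 2 = j.val % 2) := by
  revert i j
  decide

/-- The matrix of the Lichnerowicz Laplacian of the standard Einstein metric
on `SO(6)/T³`, indexed by pairs `(s, ε)` with `s` a 2-element subset of `{1,2,3}` and
`ε ∈ {1,2}`, has characteristic polynomial `X (X - 1/2)³ (X - 3/4)²`. -/
theorem stmt10
    (L : Matrix ({s : Finset (Fin 3) // s.card = 2} × Fin 2)
          ({s : Finset (Fin 3) // s.card = 2} × Fin 2) ℚ)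
    (hL : ∀ p q, L p q =
      if p.1 = q.1 then (if p.2 = q.2 then 1 / 2 else 0) else -1 / 8) :
    L.charpoly = X * (X - C (1 / 2)) ^ 3 * (X - C (3 / 4)) ^ 2 := by
  let e := Equiv.ofBijective idx10 idx10_bij
  have h : Matrix.reindex e.symm e.symm L = P10 * (Matrix.diagonal d10 * Q10) := by
    ext i j
    have h1 : Matrix.reindex e.symm e.symm L i j = L (idx10 i) (idx10 j) := rfl
    rw [h1, hL]
    simp only [(idx10_same i j).1, (idx10_same i j).2]
    fin_cases i <;> fin_cases j <;>
      simp [P10, Q10, d10, Matrix.mul_apply, Matrix.diagonal_mul, Fin.sum_univ_succ] <;> norm_num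
  rw [← Matrix.charpoly_reindex e.symm L, h, Matrix.charpoly_mul_comm, Matrix.mul_assoc, QP10,
    Matrix.mul_one, Matrix.charpoly_diagonal]
  simp only [Fin.prod_univ_six, d10]
  simp
  ring
end

section
/- The characteristic polynomial of M equals X · (X − m/(2(m−2)))^{l−1} · (X − (m−1−2κ)/(m−2))^{l(l−1)/2}. (This computes the full spectrum of the Lichnerowicz Laplacian of the standard Einstein metric on the spaces SO(m)/K₁×⋯×K_l of Wang–Ziller's conceptual construction when no Grassmannians or spheres occur: eigenvalue 0 with multiplicity 1, the smallest eigenvalue m/(2(m−2)) with multiplicity l−1, and the largest eigenvalue (m−1−2κ)/(m−2) with multiplicity l(l−1)/2.) -/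
open Polynomial Finset

/-- The index set: `l` symbols `(i)` together with the unordered pairs `(ij)`, `i ≠ j`. -/
abbrev WZIndex (l : ℕ) := Fin l ⊕ {s : Finset (Fin l) // s.card = 2}

/-- The matrix of the Lichnerowicz Laplacian of the standard Einstein metric of the spaces
`SO(m)/K₁×⋯×K_l` (Wang–Ziller's conceptual construction, no Grassmannians or spheres):
here `m = m₁ + ⋯ + m_l`, `d i = m i (m i - 1)/2 - κ m i`, and the entries are
`M (i)(i) = (m - m i)/(m-2)`,
`M (ij)(ij) = (m - m i - m j + d i/m i + d j/m j)/(m-2)`,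
`M (ij)(i) = -√(d i · m j / m i)/(m-2)`,
`M (ij)(ik) = -√(m j · m k)/(2(m-2))`, and all other entries zero. -/
noncomputable def WZMatrix (l : ℕ) (mm : Fin l → ℝ) (κ : ℝ) :
    Matrix (WZIndex l) (WZIndex l) ℝ :=
  let m : ℝ := ∑ i, mm i
  let d : Fin l → ℝ := fun i => mm i * (mm i - 1) / 2 - κ * mm i
  fun p q =>
    match p, q with
    | Sum.inl i, Sum.inl j => if i = j then (m - mm i) / (m - 2) else 0
    | Sum.inl i, Sum.inr s =>
        if i ∈ s.1 then
          -Real.sqrt (d i * (∑ h ∈ s.1.erase i, mm h) / mm i) / (m - 2)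
        else 0
    | Sum.inr s, Sum.inl i =>
        if i ∈ s.1 then
          -Real.sqrt (d i * (∑ h ∈ s.1.erase i, mm h) / mm i) / (m - 2)
        else 0
    | Sum.inr s, Sum.inr t =>
        if s = t then
          (m - (∑ h ∈ s.1, mm h) + ∑ h ∈ s.1, d h / mm h) / (m - 2)
        else if (s.1 ∩ t.1).card = 1 then
          -Real.sqrt ((∑ h ∈ s.1 \ t.1, mm h) * (∑ h ∈ t.1 \ s.1, mm h)) / (2 * (m - 2))
        else 0

/-- The square-root factor of the matrix. -/
noncomputable def WZFactor (l : ℕ) (mm : Fin l → ℝ) (κ : ℝ) : Matrix (WZIndex l) (Fin l) ℝ :=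
  fun p k =>
    match p with
    | Sum.inl i => if i = k then Real.sqrt (mm i - 1 - 2 * κ) else 0
    | Sum.inr s => if k ∈ s.1 then Real.sqrt ((∑ h ∈ s.1.erase k, mm h) / 2) else 0

lemma wz_pair_sum {l : ℕ} (f : {s : Finset (Fin l) // s.card = 2} → ℝ) (i j : Fin l)
    (hij : i ≠ j) :
    ∑ s, (if i ∈ s.1 ∧ j ∈ s.1 then f s else 0) = f ⟨{i, j}, Finset.card_pair hij⟩ := by
  rw [Finset.sum_eq_single ⟨{i, j}, Finset.card_pair hij⟩]
  · simp
  · rintro ⟨s, hs⟩ - hne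
    rw [if_neg]
    rintro ⟨h1, h2⟩
    apply hne
    apply Subtype.ext
    symm
    apply Finset.eq_of_subset_of_card_le
    · intro x hx
      simp only [Finset.mem_insert, Finset.mem_singleton] at hx
      rcases hx with rfl | rfl <;> assumption
    · rw [hs, Finset.card_pair hij]
  · simp

lemma wz_erase_left {l : ℕ} {i j : Fin l} (hij : i ≠ j) :
    ({i, j} : Finset (Fin l)).erase i = {j} := by
  ext x; simp only [mem_erase, mem_insert, mem_singleton]; grind

lemma wz_erase_right {l : ℕ} {i j : Fin l} (hij : i ≠ j) :
    ({i, j} : Finset (Fin l)).erase j = {i} := by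
  ext x; simp only [mem_erase, mem_insert, mem_singleton]; grind

lemma wz_small (l : ℕ) (mm : Fin l → ℝ) (κ : ℝ)
    (hmm : ∀ i, 0 < mm i) (he : ∀ i, 0 < mm i - 1 - 2 * κ) :
    (WZFactor l mm κ).transpose * WZFactor l mm κ =
      Matrix.scalar (Fin l) ((∑ i, mm i) / 2 - 1 - 2 * κ) +
        (1 / 2 : ℝ) • Matrix.vecMulVec (fun i => Real.sqrt (mm i)) (fun i => Real.sqrt (mm i)) := by
  ext i j
  rw [Matrix.mul_apply, Fintype.sum_sum_type]
  simp only [Matrix.transpose_apply, WZFactor, Matrix.add_apply, Matrix.scalar_apply,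
    Matrix.smul_apply, Matrix.vecMulVec_apply, smul_eq_mul]
  by_cases hij : i = j
  · subst hij
    have h1 : ∑ x, ((if x = i then Real.sqrt (mm x - 1 - 2 * κ) else 0) *
        (if x = i then Real.sqrt (mm x - 1 - 2 * κ) else 0)) = mm i - 1 - 2 * κ := by
      rw [Finset.sum_eq_single i]
      · simp [Real.mul_self_sqrt (he i).le]
      · intro b _ hb; simp [hb]
      · simp
    have h2 : ∀ x : {s : Finset (Fin l) // s.card = 2},
        ((if i ∈ x.1 then Real.sqrt ((∑ h ∈ x.1.erase i, mm h) / 2) else 0) *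
        (if i ∈ x.1 then Real.sqrt ((∑ h ∈ x.1.erase i, mm h) / 2) else 0)) =
        ∑ h ∈ univ.erase i, (if h ∈ x.1 ∧ i ∈ x.1 then mm h / 2 else 0) := by
      intro x
      by_cases hx : i ∈ x.1
      · simp only [hx, if_true, and_true]
        rw [Real.mul_self_sqrt (div_nonneg (Finset.sum_nonneg fun h _ => (hmm h).le) (by norm_num)),
          Finset.sum_div, ← Finset.sum_filter]
        apply Finset.sum_congr _ fun _ _ => rfl
        ext y; simp
      · simp [hx]
    rw [h1, Finset.sum_congr rfl fun x _ => h2 x, Finset.sum_comm,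
      Finset.sum_congr rfl fun h hh => wz_pair_sum (fun _ => mm h / 2) h i (Finset.ne_of_mem_erase hh),
      ← Finset.sum_div, Real.mul_self_sqrt (hmm i).le]
    have := Finset.sum_erase_add univ mm (Finset.mem_univ i)
    simp only [Matrix.diagonal_apply_eq]
    linarith
  · have h1 : ∑ x, ((if x = i then Real.sqrt (mm x - 1 - 2 * κ) else 0) *
        (if x = j then Real.sqrt (mm x - 1 - 2 * κ) else 0)) = 0 := by
      apply Finset.sum_eq_zero
      intro x _
      by_cases hx : x = i
      · subst hx; simp [hij]
      · simp [hx]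
    rw [h1]
    have h2 := wz_pair_sum (fun x : {s : Finset (Fin l) // s.card = 2} =>
      Real.sqrt ((∑ h ∈ x.1.erase i, mm h) / 2) * Real.sqrt ((∑ h ∈ x.1.erase j, mm h) / 2)) i j hij
    simp only [ite_zero_mul_ite_zero]
    rw [h2]
    simp only [wz_erase_left hij, wz_erase_right hij, Finset.sum_singleton]
    rw [Matrix.diagonal_apply_ne _ hij, Real.sqrt_div (hmm j).le, Real.sqrt_div (hmm i).le,
      div_mul_div_comm, Real.mul_self_sqrt (by norm_num)]
    ring

lemma wz_big_pair (l : ℕ) (mm : Fin l → ℝ)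
    (hmm : ∀ i, 0 < mm i) (s t : {s : Finset (Fin l) // s.card = 2}) :
    ∑ k, ((if k ∈ s.1 then Real.sqrt ((∑ h ∈ s.1.erase k, mm h) / 2) else 0) *
        (if k ∈ t.1 then Real.sqrt ((∑ h ∈ t.1.erase k, mm h) / 2) else 0)) =
      if s = t then (∑ h ∈ s.1, mm h) / 2
      else if (s.1 ∩ t.1).card = 1 then
        Real.sqrt ((∑ h ∈ s.1 \ t.1, mm h) * (∑ h ∈ t.1 \ s.1, mm h)) / 2
      else 0 := by
  simp only [ite_zero_mul_ite_zero, ← Finset.mem_inter]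
  rw [Finset.sum_ite_mem, Finset.univ_inter]
  obtain ⟨s, hs⟩ := s
  obtain ⟨t, ht⟩ := t
  simp only [Subtype.mk.injEq]
  split_ifs with h1 h2
  · subst h1
    obtain ⟨a, b, hab, rfl⟩ := Finset.card_eq_two.1 hs
    rw [Finset.inter_self, Finset.sum_pair hab, Finset.sum_pair hab, wz_erase_left hab,
      wz_erase_right hab, Finset.sum_singleton, Finset.sum_singleton,
      Real.mul_self_sqrt (by have := hmm b; positivity),
      Real.mul_self_sqrt (by have := hmm a; positivity)]
    ring
  · obtain ⟨a, ha⟩ := Finset.card_eq_one.1 h2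
    have e1 : s.erase a = s \ t := by
      rw [← Finset.sdiff_inter_self_left, ha, Finset.sdiff_singleton_eq_erase]
    have e2 : t.erase a = t \ s := by
      rw [← Finset.sdiff_inter_self_left, Finset.inter_comm, ha, Finset.sdiff_singleton_eq_erase]
    have p1 : 0 ≤ ∑ h ∈ s \ t, mm h := Finset.sum_nonneg fun h _ => (hmm h).le
    have p2 : 0 ≤ ∑ h ∈ t \ s, mm h := Finset.sum_nonneg fun h _ => (hmm h).le
    rw [ha, Finset.sum_singleton, e1, e2, Real.sqrt_div p1, Real.sqrt_div p2, div_mul_div_comm,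
      Real.mul_self_sqrt (by norm_num), Real.sqrt_mul p1]
  · have h3 : (s ∩ t).card ≤ 2 := hs ▸ Finset.card_le_card Finset.inter_subset_left
    have h4 : (s ∩ t).card ≠ 2 := by
      intro h
      apply h1
      have a1 := Finset.eq_of_subset_of_card_le (Finset.inter_subset_left (s₁ := s) (s₂ := t)) (by omega)
      have a2 := Finset.eq_of_subset_of_card_le (Finset.inter_subset_right (s₁ := s) (s₂ := t)) (by omega)
      rw [← a1, a2]
    have : s ∩ t = ∅ := Finset.card_eq_zero.1 (by omega)
    rw [this, Finset.sum_empty]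

lemma wz_mixed (l : ℕ) (mm : Fin l → ℝ) (κ : ℝ)
    (hmm : ∀ i, 0 < mm i) (he : ∀ i, 0 < mm i - 1 - 2 * κ) (i : Fin l)
    (s : {s : Finset (Fin l) // s.card = 2}) :
    ∑ k, ((if i = k then Real.sqrt (mm i - 1 - 2 * κ) else 0) *
        (if k ∈ s.1 then Real.sqrt ((∑ h ∈ s.1.erase k, mm h) / 2) else 0)) =
      if i ∈ s.1 then
        Real.sqrt ((mm i * (mm i - 1) / 2 - κ * mm i) * (∑ h ∈ s.1.erase i, mm h) / mm i)
      else 0 := by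
  simp only [ite_mul, zero_mul, Finset.sum_ite_eq, Finset.mem_univ, if_true]
  rw [mul_ite, mul_zero]
  split_ifs with h
  · rw [← Real.sqrt_mul (he i).le]
    congr 1
    have := (hmm i).ne'
    field_simp
  · rfl

lemma wz_big (l : ℕ) (mm : Fin l → ℝ) (κ : ℝ)
    (hmm : ∀ i, 0 < mm i) (hm : 2 < ∑ i, mm i) (he : ∀ i, 0 < mm i - 1 - 2 * κ) :
    WZMatrix l mm κ - Matrix.scalar (WZIndex l) (((∑ i, mm i) - 1 - 2 * κ) / ((∑ i, mm i) - 2)) =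
      WZFactor l mm κ * ((-1 / ((∑ i, mm i) - 2)) • (WZFactor l mm κ).transpose) := by
  have hm2 : (∑ i, mm i) - 2 ≠ 0 := by linarith
  rw [Matrix.mul_smul]
  ext p q
  rw [Matrix.smul_apply, Matrix.mul_apply, Matrix.sub_apply, smul_eq_mul, Matrix.scalar_apply]
  simp only [Matrix.transpose_apply]
  rcases p with i | s <;> rcases q with j | t
  · simp only [WZFactor, WZMatrix]
    by_cases hij : i = j
    · subst hij
      simp only [ite_zero_mul_ite_zero, and_self, Finset.sum_ite_eq, Finset.mem_univ, if_true,
        Matrix.diagonal_apply_eq, Real.mul_self_sqrt (he i).le]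
      field_simp
      ring
    · rw [Matrix.diagonal_apply_ne _ (by simpa using hij), if_neg hij]
      simp only [ite_mul, zero_mul, Finset.sum_ite_eq, Finset.mem_univ, if_true]
      rw [if_neg (Ne.symm hij)]
      simp
  · simp only [WZFactor, WZMatrix]
    rw [wz_mixed l mm κ hmm he, Matrix.diagonal_apply_ne _ (by simp)]
    split_ifs <;> ring
  · simp only [WZFactor, WZMatrix]
    rw [Finset.sum_congr rfl fun k _ => mul_comm _ _, wz_mixed l mm κ hmm he,
      Matrix.diagonal_apply_ne _ (by simp)]
    split_ifs <;> ring
  · simp only [WZFactor, WZMatrix]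
    rw [wz_big_pair l mm hmm]
    by_cases hst : s = t
    · subst hst
      simp only [if_true, Matrix.diagonal_apply_eq]
      have : ∑ h ∈ s.1, (mm h * (mm h - 1) / 2 - κ * mm h) / mm h
          = (∑ h ∈ s.1, mm h) / 2 - 1 - 2 * κ := by
        rw [Finset.sum_congr rfl (g := fun h => mm h / 2 - (1 / 2 + κ)) fun h _ => by
          have := (hmm h).ne'
          field_simp
          ring]
        rw [Finset.sum_sub_distrib, Finset.sum_const, s.2, Finset.sum_div, nsmul_eq_mul]
        push_cast
        ring
      rw [this]
      field_simp
      ring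
    · rw [Matrix.diagonal_apply_ne _ (by simpa using hst), if_neg hst, if_neg hst]
      split_ifs
      · field_simp
        ring
      · simp

lemma wz_shift {n : Type*} [Fintype n] [DecidableEq n] (M : Matrix n n ℝ) (μ : ℝ) (p : ℝ[X])
    (h : (M - Matrix.scalar n μ).charpoly = p) : M.charpoly = p.comp (X - C μ) := by
  rw [← h, Matrix.charpoly_sub_scalar, Polynomial.comp_assoc]
  simp

/-- Under the assumptions `l ≥ 2`, `m i > 0`, `m = ∑ m i > 2` and `d i > 0`,
the characteristic polynomial of the above matrix is
`X (X - m/(2(m-2)))^(l-1) (X - (m-1-2κ)/(m-2))^(l(l-1)/2)`. -/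
theorem stmt14 (l : ℕ) (hl : 2 ≤ l) (mm : Fin l → ℝ) (κ : ℝ)
    (hmm : ∀ i, 0 < mm i) (hm : 2 < ∑ i, mm i)
    (hd : ∀ i, 0 < mm i * (mm i - 1) / 2 - κ * mm i) :
    (WZMatrix l mm κ).charpoly =
      X * (X - C ((∑ i, mm i) / (2 * ((∑ i, mm i) - 2)))) ^ (l - 1) *
        (X - C (((∑ i, mm i) - 1 - 2 * κ) / ((∑ i, mm i) - 2))) ^ (l * (l - 1) / 2) := by
  have he : ∀ i, 0 < mm i - 1 - 2 * κ := by
    intro i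
    have h1 := hd i
    have h2 : mm i * (mm i - 1) / 2 - κ * mm i = mm i * ((mm i - 1 - 2 * κ) / 2) := by ring
    rw [h2] at h1
    have := pos_of_mul_pos_right h1 (hmm i).le
    linarith
  have hm2 : (∑ i, mm i) - 2 ≠ 0 := by linarith
  have hcard : Fintype.card (WZIndex l) = l + l * (l - 1) / 2 := by
    rw [Fintype.card_sum, Fintype.card_finset_len, Fintype.card_fin, Nat.choose_two_right]
  have hsmall := wz_small l mm κ hmm he
  have hbig := wz_big l mm κ hmm hm he
  set m := ∑ i, mm i with hmdef
  set A := WZFactor l mm κ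
  have hQ : ((-1 / (m - 2)) • A.transpose * A).charpoly =
      (X ^ l - (-1 / (m - 2) * (m / 2)) • X ^ (l - 1) : ℝ[X]).comp
        (X - C (-1 / (m - 2) * (m / 2 - 1 - 2 * κ))) := by
    apply wz_shift
    have : (-1 / (m - 2)) • A.transpose * A
        - Matrix.scalar (Fin l) (-1 / (m - 2) * (m / 2 - 1 - 2 * κ)) =
        Matrix.vecMulVec (fun i => (-1 / (m - 2) * (1 / 2)) * Real.sqrt (mm i))
          (fun i => Real.sqrt (mm i)) := by
      rw [Matrix.smul_mul, hsmall]
      ext i j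
      by_cases hij : i = j
      · subst hij
        simp [Matrix.vecMulVec_apply]
        ring
      · simp [Matrix.vecMulVec_apply, hij]
        ring
    rw [this, Matrix.charpoly_vecMulVec, Fintype.card_fin]
    congr 2
    simp only [dotProduct]
    rw [hmdef, Finset.sum_div, Finset.mul_sum]
    apply Finset.sum_congr rfl
    intro i _
    rw [mul_assoc, Real.mul_self_sqrt (hmm i).le]
    ring
  have hM := wz_shift _ _ _ (congrArg Matrix.charpoly hbig)
  rw [hM, Matrix.charpoly_mul_comm_of_le _ _ (by rw [hcard, Fintype.card_fin]; omega), hQ, hcard,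
    Fintype.card_fin, Nat.add_sub_cancel_left]
  obtain ⟨n, rfl⟩ : ∃ n, l = n + 1 := ⟨l - 1, by omega⟩
  simp only [Nat.add_sub_cancel, Polynomial.smul_eq_C_mul, mul_comp, sub_comp, pow_comp, X_comp,
    C_comp]
  have k1 : (X - C ((m - 1 - 2 * κ) / (m - 2)) - C (-1 / (m - 2) * (m / 2 - 1 - 2 * κ)) : ℝ[X])
      = X - C (m / (2 * (m - 2))) := by
    rw [sub_sub, ← C_add]
    congr 2
    field_simp
    ring
  have k2 : (C (-1 / (m - 2) * (m / 2)) : ℝ[X]) = - C (m / (2 * (m - 2))) := by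
    rw [← C_neg]
    congr 1
    field_simp
  rw [k1, k2]
  ring
end

section
/- The characteristic polynomial of L equals X · (X − 4/5)⁷ · (X − 14/15)⁶; that is, L has eigenvalues 0, 4/5 and 14/15 with multiplicities 1, 7 and 6. (This computes the spectrum of the Lichnerowicz Laplacian of the standard Einstein metric on E₈/SU(2)⁸, whose smallest nonzero eigenvalue 4/5 exceeds twice the Einstein constant 2ρ = 3/5, so the metric is G-stable.) -/
open Polynomial

/-- Integer matrix whose columns are eigenvectors. -/
def eigP : Matrix (Fin 7 × Fin 2) (Fin 7 × Fin 2) ℤ := fun p q =>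
  if q.2 = 1 then (if p.1 = q.1 then (if p.2 = 0 then 1 else -1) else 0)
  else if q.1 = 0 then 1
  else if p.1 = q.1 then 1 else if p.1 = 0 then -1 else 0

/-- `14` times the inverse of `eigP`. -/
def eigQ : Matrix (Fin 7 × Fin 2) (Fin 7 × Fin 2) ℤ := fun q p =>
  if q.2 = 1 then (if p.1 = q.1 then (if p.2 = 0 then 7 else -7) else 0)
  else if q.1 = 0 then 1
  else if p.1 = q.1 then 6 else -1

/-- `15` times the eigenvalues. -/
def eigD : Fin 7 × Fin 2 → ℤ := fun q =>
  if q.2 = 1 then 12 else if q.1 = 0 then 0 else 14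

lemma eigQP : ∀ p q : Fin 7 × Fin 2, (∑ r, eigQ p r * eigP r q) = if p = q then 14 else 0 := by
  simp only [Fintype.sum_prod_type, Fin.sum_univ_two, Fin.sum_univ_seven]
  decide +kernel

lemma eigPDQ : ∀ p q : Fin 7 × Fin 2, (∑ r, eigP p r * (eigD r * eigQ r q)) =
    if p.1 = q.1 then (if p.2 = q.2 then 168 else 0) else -14 := by
  simp only [Fintype.sum_prod_type, Fin.sum_univ_two, Fin.sum_univ_seven]
  decide +kernel

/-- The `14 × 14` matrix of the Lichnerowicz Laplacian of the standard
Einstein metric on `E₈/SU(2)⁸`, indexed by pairs `(a,x)` with `a ∈ {1,…,7}`, `x ∈ {1,2}`, with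
entries `4/5` on the diagonal, `0` for `a = b`, `x ≠ y`, and `-1/15` for `a ≠ b`, has
characteristic polynomial `X (X - 4/5)⁷ (X - 14/15)⁶`. -/
theorem stmt19
    (L : Matrix (Fin 7 × Fin 2) (Fin 7 × Fin 2) ℚ)
    (hL : ∀ p q, L p q =
      if p.1 = q.1 then (if p.2 = q.2 then 4 / 5 else 0) else -1 / 15) :
    L.charpoly = X * (X - C (4 / 5)) ^ 7 * (X - C (14 / 15)) ^ 6 := by
  set P : Matrix (Fin 7 × Fin 2) (Fin 7 × Fin 2) ℚ := fun p q => (eigP p q : ℚ) with hP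
  set Q : Matrix (Fin 7 × Fin 2) (Fin 7 × Fin 2) ℚ := fun p q => (eigQ p q : ℚ) / 14 with hQ
  set D : Fin 7 × Fin 2 → ℚ := fun p => (eigD p : ℚ) / 15 with hD
  have h1 : L = P * (Matrix.diagonal D * Q) := by
    ext p q
    have h := congrArg (fun z : ℤ => (z : ℚ) / 210) (eigPDQ p q)
    simp only [Int.cast_sum, Int.cast_mul, Finset.sum_div] at h
    have h' : (P * (Matrix.diagonal D * Q)) p q =
        ∑ r, (eigP p r : ℚ) * ((eigD r : ℚ) * (eigQ r q : ℚ)) / 210 := by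
      rw [Matrix.mul_apply]
      refine Finset.sum_congr rfl fun r _ => ?_
      rw [Matrix.diagonal_mul]
      simp only [hP, hQ, hD]
      ring
    rw [h', h, hL]
    split_ifs <;> norm_num
  have h2 : Q * P = 1 := by
    ext p q
    have h := congrArg (fun z : ℤ => (z : ℚ) / 14) (eigQP p q)
    simp only [Int.cast_sum, Int.cast_mul, Finset.sum_div] at h
    have h' : (Q * P) p q = ∑ r, (eigQ p r : ℚ) * (eigP r q : ℚ) / 14 := by
      rw [Matrix.mul_apply]
      refine Finset.sum_congr rfl fun r _ => ?_
      simp only [hP, hQ]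
      ring
    rw [h', h, Matrix.one_apply]
    split_ifs <;> norm_num
  rw [h1, Matrix.charpoly_mul_comm, Matrix.mul_assoc, h2, Matrix.mul_one,
    Matrix.charpoly_diagonal, Fintype.prod_prod_type]
  have e1 : (12 : ℚ) / 15 = 4 / 5 := by norm_num
  simp only [Fin.prod_univ_two, Fin.prod_univ_succ (n := 6), hD, eigD]
  simp [Fin.succ_ne_zero, e1, -map_div₀]
  ring
end
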